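/- Let n_1, n_2, … be a lacunary sequence of positive integers and let ε > 0. Then there exists a set 𝒢 ⊆ Bad with Hausdorff dimension dim_H(𝒢) = 1 such that for every β ∈ 𝒢 and every δ ∈ ℝ, there are infinitely many positive integers t with ‖n_t β − δ‖ < (log t)^(3+ε) / t. -/

import Mathlib

open Real MeasureTheory Set

/-- Distance from `x` to the nearest integer. -/
noncomputable def nint (x : ℝ) : ℝ := ⨅ n : ℤ, |x - n|

/-- The set of badly approximable numbers. -/
def Bad : Set ℝ := {α : ℝ | ∃ c > 0, ∀ n : ℕ, 1 ≤ n → c ≤ n * nint (n * α)}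

/-- The set of `δ`-inhomogeneously badly approximable numbers. -/
def BadShift (δ : ℝ) : Set ℝ := {β : ℝ | ∃ c > 0, ∀ n : ℕ, 1 ≤ n → c ≤ n * nint (n * β - δ)}

/-- The set `ℬ = {(β, δ) : β ∈ Bad ∩ Bad(δ)}`. -/
def calB : Set (ℝ × ℝ) := {p : ℝ × ℝ | p.1 ∈ Bad ∧ p.1 ∈ BadShift p.2}

/-- The `k`-th continuant `q_k(α)` (denominator of the `k`-th convergent) of the
continued fraction expansion of `α`. -/
noncomputable def contDen (α : ℝ) (k : ℕ) : ℝ := (GenContFract.of α).dens k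

/-- `Λ(α) = sup_{k ≥ 1} (log q_k(α)) / k`. -/
noncomputable def Lam (α : ℝ) : ℝ := ⨆ k : ℕ+, Real.log (contDen α k) / k

/-- Membership in the set `𝒦` of irrational numbers with `Λ(α) < ∞`. -/
def memK (α : ℝ) : Prop :=
  Irrational α ∧ BddAbove (Set.range fun k : ℕ+ => Real.log (contDen α k) / k)

/-- The Fourier transform `μ̂(ξ) = ∫ e^{-2πiξx} dμ(x)` of a measure `μ` on `ℝ`. -/
noncomputable def mFT (μ : Measure ℝ) (ξ : ℝ) : ℂ :=
  ∫ x, Complex.exp (-(2 * Real.pi * ξ * x : ℝ) * Complex.I) ∂μ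

/-- Dispersion of a (finite) set `A ⊆ [0,1)`: the largest gap between circularly
consecutive elements, where the gap between the largest and the smallest element
wraps around, i.e. equals `min A + 1 - max A`. -/
noncomputable def disp (A : Set ℝ) : ℝ :=
  sSup {d : ℝ |
    (∃ a ∈ A, ∃ b ∈ A, a < b ∧ (∀ x ∈ A, x ≤ a ∨ b ≤ x) ∧ d = b - a) ∨
    (∃ a ∈ A, ∃ b ∈ A, (∀ x ∈ A, b ≤ x ∧ x ≤ a) ∧ d = b + 1 - a)}

/-- Every point of `[a, a + ℓ]` is badly approximable with constant `1 / (8 R²)` by the rationals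
whose denominator `q` satisfies `2 R ℓ q² ≤ 1`. -/
def GoodInterval (R a ℓ : ℝ) : Prop :=
  ∀ p q : ℤ, 0 < q → 2 * R * ℓ * (q : ℝ) ^ 2 ≤ 1 → ∀ x ∈ Icc a (a + ℓ),
    1 ≤ 8 * R ^ 2 * (q * |q * x - p|)

theorem one_le_abs_mul_sub_mul {p q p' q' : ℤ} (h : p * q' ≠ p' * q) :
    (1 : ℝ) ≤ |(p : ℝ) * q' - p' * q| := by
  have : 1 ≤ |p * q' - p' * q| := Int.one_le_abs (sub_ne_zero.mpr h)
  exact_mod_cast this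

set_option maxHeartbeats 1000000 in
/-- Of the `R` equal parts of a good interval, two which are not good are equal or adjacent. -/
theorem GoodInterval.bad_parts_adjacent {R : ℕ} (hR : 2 ≤ R) {a ℓ : ℝ} (hℓ : 0 < ℓ)
    (h : GoodInterval R a ℓ) {i j : ℕ} (hi : i < R) (hj : j < R)
    (hi' : ¬ GoodInterval R (a + i * (ℓ / R)) (ℓ / R))
    (hj' : ¬ GoodInterval R (a + j * (ℓ / R)) (ℓ / R)) : i ≤ j + 1 := by
  have hR0 : (2 : ℝ) ≤ R := by exact_mod_cast hR
  set s := ℓ / R with hs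
  have hs0 : 0 < s := by positivity
  have hsR : R * s = ℓ := by rw [hs]; field_simp
  have key : ∀ k : ℕ, k < R → ¬ GoodInterval R (a + k * s) s →
      ∃ p q : ℤ, 0 < q ∧ 2 * ℓ * (q : ℝ) ^ 2 ≤ 1 ∧ ∃ x ∈ Icc (a + k * s) (a + k * s + s),
        |q * x - p| < q * (s / 4) := by
    intro k hk hb
    unfold GoodInterval at hb
    push Not at hb
    obtain ⟨p, q, hq, hq2, x, hx, hlt⟩ := hb
    have hq0 : (0 : ℝ) < q := by exact_mod_cast hq
    refine ⟨p, q, hq, by rw [← hsR]; linarith, x, hx, ?_⟩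
    have hk1 : (k : ℝ) + 1 ≤ R := by exact_mod_cast hk
    have hxI : x ∈ Icc a (a + ℓ) := by
      refine ⟨le_trans ?_ hx.1, le_trans hx.2 ?_⟩
      · have : 0 ≤ (k : ℝ) * s := by positivity
        linarith
      · rw [← hsR]; nlinarith
    by_contra hcon
    push Not at hcon
    by_cases hsmall : 2 * (R : ℝ) * ℓ * (q : ℝ) ^ 2 ≤ 1
    · have := h p q hq hsmall x hxI
      linarith
    · push Not at hsmall
      have h1 : (q : ℝ) * (q * (s / 4)) ≤ q * |q * x - p| := by gcongr
      have h2 : 8 * (R : ℝ) ^ 2 * (q * (q * (s / 4))) ≤ 8 * (R : ℝ) ^ 2 * (q * |q * x - p|) := by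
        gcongr
      have h3 : 8 * (R : ℝ) ^ 2 * (q * (q * (s / 4))) = 2 * R * ℓ * (q : ℝ) ^ 2 := by
        rw [← hsR]; ring
      linarith
  obtain ⟨p, q, hq, hqs, x, hx, hxp⟩ := key i hi hi'
  obtain ⟨p', q', hq', hqs', x', hx', hxp'⟩ := key j hj hj'
  have hq0 : (0 : ℝ) < q := by exact_mod_cast hq
  have hq0' : (0 : ℝ) < q' := by exact_mod_cast hq'
  have hi1 : (i : ℝ) + 1 ≤ R := by exact_mod_cast hi
  have hj1 : (j : ℝ) + 1 ≤ R := by exact_mod_cast hj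
  have hid : q * q' * (x - x') + (q * p' - q' * p : ℝ) =
      q' * (q * x - p) - q * (q' * x' - p') := by ring
  have hA := abs_lt.mp hxp
  have hB := abs_lt.mp hxp'
  have hup : q * q' * (x - x') + (q * p' - q' * p : ℝ) < q * q' * (s / 2) := by
    rw [hid]; nlinarith
  have hlow : -(q * q' * (s / 2)) < q * q' * (x - x') + (q * p' - q' * p : ℝ) := by
    rw [hid]; nlinarith
  have hqq : 0 < (q : ℝ) * q' := by positivity
  by_cases heq : p * q' = p' * q
  · have heq' : (p : ℝ) * q' = p' * q := by exact_mod_cast heq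
    have : q * q' * (x - x') < q * q' * (s / 2) := by nlinarith
    have hxx : x - x' < s / 2 := lt_of_mul_lt_mul_left this hqq.le
    have : (i : ℝ) * s < (j + 2) * s := by nlinarith [hx.1, hx'.2]
    have : (i : ℝ) < j + 2 := lt_of_mul_lt_mul_right this hs0.le
    have : i < j + 2 := by exact_mod_cast this
    omega
  · exfalso
    have h1 := one_le_abs_mul_sub_mul heq
    have hxx : |x - x'| ≤ ℓ := by
      rw [abs_le, ← hsR]
      have h0 : (0 : ℝ) ≤ i * s := by positivity
      have h0' : (0 : ℝ) ≤ j * s := by positivity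
      constructor <;> nlinarith [hx.1, hx'.2, hx.2, hx'.1]
    have h2 : |(p : ℝ) * q' - p' * q| ≤ q * q' * ℓ + q * q' * (s / 2) := by
      have e : (p : ℝ) * q' - p' * q = q * q' * (x - x') -
          (q * q' * (x - x') + (q * p' - q' * p : ℝ)) := by ring
      rw [e]
      refine (abs_sub _ _).trans (add_le_add ?_ ?_)
      · rw [abs_mul, abs_of_pos hqq]; gcongr
      · rw [abs_le]; constructor <;> linarith
    have h3 : 2 * ℓ * ((q : ℝ) * q') ≤ 1 := by
      linarith [mul_nonneg hℓ.le (sq_nonneg ((q : ℝ) - q'))]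
    have h4 : s / 2 ≤ ℓ / 2 := by
      have : 1 * s ≤ R * s := by gcongr; linarith
      linarith
    have h5 : q * q' * (s / 2) ≤ q * q' * (ℓ / 2) := by gcongr
    have h6 : 0 < (q : ℝ) * q' * ℓ := by positivity
    linarith

/-- A good interval has `b` good subintervals of relative length `1 / (4 b)` that are separated. -/
theorem GoodInterval.exists_separated_parts {b : ℕ} (hb : 1 ≤ b) {a ℓ : ℝ} (hℓ : 0 < ℓ)
    (h : GoodInterval (4 * b : ℕ) a ℓ) :
    ∃ f : ℕ → ℕ, StrictMono (fun d => f d) ∧ (∀ d, f d + 2 ≤ f (d + 1)) ∧ ∀ d < b, f d < 4 * b ∧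
      GoodInterval (4 * b : ℕ) (a + f d * (ℓ / (4 * b : ℕ))) (ℓ / (4 * b : ℕ)) := by
  by_cases hk : ∃ k, 2 * k < 4 * b ∧
      ¬ GoodInterval (4 * b : ℕ) (a + (2 * k : ℕ) * (ℓ / (4 * b : ℕ))) (ℓ / (4 * b : ℕ))
  · obtain ⟨k, hk1, hk2⟩ := hk
    have hgood : ∀ d, 2 * d < 4 * b → d ≠ k →
        GoodInterval (4 * b : ℕ) (a + (2 * d : ℕ) * (ℓ / (4 * b : ℕ))) (ℓ / (4 * b : ℕ)) := by
      intro d hd hdk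
      by_contra hcon
      have h1 := h.bad_parts_adjacent (by omega) hℓ hd hk1 hcon hk2
      have h2 := h.bad_parts_adjacent (by omega) hℓ hk1 hd hk2 hcon
      omega
    refine ⟨fun d => if d < k then 2 * d else 2 * (d + 1), ?_, ?_, ?_⟩
    · apply strictMono_nat_of_lt_succ
      intro d; dsimp only; split_ifs <;> omega
    · intro d; dsimp only; split_ifs <;> omega
    · intro d hd
      dsimp only
      split_ifs with hdk
      · exact ⟨by omega, hgood d (by omega) (by omega)⟩
      · exact ⟨by omega, hgood (d + 1) (by omega) (by omega)⟩
  · push Not at hk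
    refine ⟨fun d => 2 * d, fun x y hxy => by dsimp only; omega, fun d => by dsimp only; omega,
      fun d hd => ⟨by dsimp only; omega, hk d (by omega)⟩⟩

/-- If `E` occupies a sufficiently small proportion of a good interval, then some good subinterval
of relative length `R⁻ᵏ` is not almost covered by `E`. -/
theorem GoodInterval.exists_part_not_covered {R : ℕ} (hR : 2 ≤ R) (E : Set ℝ) (k : ℕ) :
    ∀ {a ℓ : ℝ}, 0 < ℓ → GoodInterval R a ℓ →
      volume.real (E ∩ Ico a (a + ℓ)) < ℓ * (1 - 2 / R) ^ k →
      ∃ a', a ≤ a' ∧ a' + ℓ / R ^ k ≤ a + ℓ ∧ GoodInterval R a' (ℓ / R ^ k) ∧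
        volume.real (E ∩ Ico a' (a' + ℓ / R ^ k)) < ℓ / R ^ k := by
  induction k with
  | zero =>
    intro a ℓ hℓ hg hE
    exact ⟨a, le_rfl, by simp, by simpa using hg, by simpa using hE⟩
  | succ k ih =>
    intro a ℓ hℓ hg hE
    classical
    have hR0 : (2 : ℝ) ≤ R := by exact_mod_cast hR
    set s := ℓ / R with hs
    have hs0 : 0 < s := by positivity
    have hsR : R * s = ℓ := by rw [hs]; field_simp
    set good := (Finset.range R).filter (fun i : ℕ => GoodInterval R (a + i * s) s) with hgood
    set bad := (Finset.range R).filter (fun i : ℕ => ¬ GoodInterval R (a + i * s) s) with hbad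
    have hcard : good.card + bad.card = R := by
      rw [hgood, hbad, Finset.card_filter_add_card_filter_not, Finset.card_range]
    have hbadcard : bad.card ≤ 2 := by
      by_cases hne : bad.Nonempty
      · have hsub : bad ⊆ Finset.Icc (bad.min' hne) (bad.min' hne + 1) := by
          intro i hi
          have hm := bad.min'_mem hne
          rw [Finset.mem_Icc]
          refine ⟨bad.min'_le i hi, ?_⟩
          generalize bad.min' hne = i₀ at hm ⊢
          rw [hbad, Finset.mem_filter, Finset.mem_range] at hi hm
          exact hg.bad_parts_adjacent hR hℓ hi.1 hm.1 hi.2 hm.2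
        refine (Finset.card_le_card hsub).trans ?_
        simp
        omega
      · rw [Finset.not_nonempty_iff_eq_empty.mp hne]; simp
    have hsum : ∑ i ∈ good, volume.real (E ∩ Ico (a + i * s) (a + i * s + s)) ≤
        volume.real (E ∩ Ico a (a + ℓ)) := by
      have hdisj : Set.PairwiseDisjoint (good : Set ℕ)
          (fun i : ℕ => Ico (a + i * s) (a + i * s + s)) := by
        intro i _ j _ hij
        rw [Function.onFun, Set.disjoint_left]
        intro x hx hx'
        rcases Nat.lt_or_gt_of_ne hij with hlt | hlt
        · have : (i : ℝ) + 1 ≤ j := by exact_mod_cast hlt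
          nlinarith [hx.2, hx'.1]
        · have : (j : ℝ) + 1 ≤ i := by exact_mod_cast hlt
          nlinarith [hx.1, hx'.2]
      have hfin : volume (E ∩ Ico a (a + ℓ)) ≠ ⊤ :=
        measure_ne_top_of_subset inter_subset_right (by simp)
      set μ := (volume.restrict (E ∩ Ico a (a + ℓ))) with hμ
      have hsubI : ∀ i ∈ good, Ico (a + (i : ℕ) * s) (a + i * s + s) ⊆ Ico a (a + ℓ) := by
        intro i hi x hx
        rw [hgood, Finset.mem_filter, Finset.mem_range] at hi
        have : (i : ℝ) + 1 ≤ R := by exact_mod_cast hi.1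
        have h0 : (0 : ℝ) ≤ i * s := by positivity
        exact ⟨by linarith [hx.1], by rw [← hsR]; nlinarith [hx.2]⟩
      have heq : ∀ i ∈ good, volume.real (E ∩ Ico (a + i * s) (a + i * s + s)) =
          μ.real (Ico (a + i * s) (a + i * s + s)) := by
        intro i hi
        rw [hμ, measureReal_restrict_apply measurableSet_Ico]
        congr 1
        ext x
        constructor
        · rintro ⟨h1, h2⟩; exact ⟨h2, h1, hsubI i hi h2⟩
        · rintro ⟨h1, h2, _⟩; exact ⟨h2, h1⟩
      rw [Finset.sum_congr rfl heq]
      have : IsFiniteMeasure μ := ⟨by rw [hμ, Measure.restrict_apply_univ]; exact hfin.lt_top⟩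
      rw [← measureReal_biUnion_finset hdisj (fun i _ => measurableSet_Ico)]
      refine (measureReal_mono (subset_univ _)).trans ?_
      rw [hμ, measureReal_restrict_apply_univ]
    have hpow : 0 ≤ (1 - 2 / (R : ℝ)) := by
      rw [sub_nonneg, div_le_one (by linarith)]; exact hR0
    have hex : ∃ i ∈ good, volume.real (E ∩ Ico (a + i * s) (a + i * s + s)) <
        s * (1 - 2 / R) ^ k := by
      by_contra hcon
      push Not at hcon
      have h1 := Finset.card_nsmul_le_sum good _ _ hcon
      rw [nsmul_eq_mul] at h1
      have h2 : (R : ℝ) - 2 ≤ good.card := by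
        have : R ≤ good.card + 2 := by omega
        have : (R : ℝ) ≤ good.card + 2 := by exact_mod_cast this
        linarith
      have h3 : ((R : ℝ) - 2) * (s * (1 - 2 / R) ^ k) ≤ good.card * (s * (1 - 2 / R) ^ k) := by
        gcongr
      have h4 : ((R : ℝ) - 2) * (s * (1 - 2 / R) ^ k) = ℓ * (1 - 2 / R) ^ (k + 1) := by
        rw [← hsR, pow_succ]; field_simp
      linarith
    obtain ⟨i, hi, hlt⟩ := hex
    have hi2 := hi
    rw [hgood, Finset.mem_filter, Finset.mem_range] at hi2
    obtain ⟨a', h1, h2, h3, h4⟩ := ih hs0 hi2.2 hlt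
    have e : s / (R : ℝ) ^ k = ℓ / R ^ (k + 1) := by rw [hs, pow_succ']; field_simp
    rw [e] at h2 h3 h4
    have hi1 : (i : ℝ) + 1 ≤ R := by exact_mod_cast hi2.1
    have h0 : (0 : ℝ) ≤ i * s := by positivity
    exact ⟨a', by linarith, by rw [← hsR] at h2 ⊢; nlinarith, h3, h4⟩

/-- First derivative test for oscillatory integrals. -/
theorem norm_integral_exp_le_of_le_abs_deriv {ψ ψ' ψ'' : ℝ → ℝ} {α β c M : ℝ} (hαβ : α ≤ β)
    (h1 : ∀ x ∈ Icc α β, HasDerivAt ψ (ψ' x) x) (h2 : ∀ x ∈ Icc α β, HasDerivAt ψ' (ψ'' x) x)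
    (h3 : ContinuousOn ψ'' (Icc α β)) (hc : 0 < c) (hψ' : ∀ x ∈ Icc α β, c ≤ |ψ' x|)
    (hψ'' : ∀ x ∈ Icc α β, |ψ'' x| ≤ M) :
    ‖∫ x in α..β, Complex.exp (ψ x * Complex.I)‖ ≤ 2 / c + M * (β - α) / c ^ 2 := by
  have hne : ∀ x ∈ Icc α β, (ψ' x : ℂ) ≠ 0 := fun x hx => by
    have := hψ' x hx
    have h0 : ψ' x ≠ 0 := fun h => by rw [h, abs_zero] at this; linarith
    exact_mod_cast h0
  set e : ℝ → ℂ := fun x => Complex.exp (ψ x * Complex.I) with he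
  set F : ℝ → ℂ := fun x => e x / (ψ' x * Complex.I) with hF
  set G : ℝ → ℂ := fun x => e x * ψ'' x / (ψ' x ^ 2 * Complex.I) with hG
  have hnorm : ∀ x, ‖e x‖ = 1 := fun x => Complex.norm_exp_ofReal_mul_I _
  have hde : ∀ x ∈ Icc α β, HasDerivAt e (e x * (ψ' x * Complex.I)) x := fun x hx =>
    ((h1 x hx).ofReal_comp.mul_const Complex.I).cexp
  have hdF : ∀ x ∈ Icc α β, HasDerivAt F (e x - G x) x := by
    intro x hx
    have h := (hde x hx).div ((h2 x hx).ofReal_comp.mul_const Complex.I)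
      (mul_ne_zero (hne x hx) Complex.I_ne_zero)
    have hE : (e x * (ψ' x * Complex.I) * (ψ' x * Complex.I) - e x * (ψ'' x * Complex.I)) /
        (ψ' x * Complex.I) ^ 2 = e x - G x := by
      have := hne x hx
      simp only [hG]
      field_simp
    exact h.congr_deriv hE
  have hce : ContinuousOn e (Icc α β) := fun x hx => (hde x hx).continuousAt.continuousWithinAt
  have hcψ' : ContinuousOn (fun x => (ψ' x : ℂ)) (Icc α β) := fun x hx =>
    ((h2 x hx).ofReal_comp).continuousAt.continuousWithinAt
  have hcψ'' : ContinuousOn (fun x => (ψ'' x : ℂ)) (Icc α β) :=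
    Complex.continuous_ofReal.comp_continuousOn h3
  have hcG : ContinuousOn G (Icc α β) :=
    (hce.mul hcψ'').div ((hcψ'.pow 2).mul continuousOn_const)
      (fun x hx => mul_ne_zero (pow_ne_zero 2 (hne x hx)) Complex.I_ne_zero)
  have hu : uIcc α β = Icc α β := uIcc_of_le hαβ
  have hiG : IntervalIntegrable G volume α β := (hu ▸ hcG).intervalIntegrable
  have hie : IntervalIntegrable e volume α β := (hu ▸ hce).intervalIntegrable
  have hsum : ∫ x in α..β, e x = (F β - F α) + ∫ x in α..β, G x := by
    rw [← intervalIntegral.integral_eq_sub_of_hasDerivAt (fun x hx => hdF x (hu ▸ hx))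
      (hie.sub hiG), intervalIntegral.integral_sub hie hiG]
    ring
  have hnF : ∀ x ∈ Icc α β, ‖F x‖ ≤ 1 / c := by
    intro x hx
    simp only [hF, norm_div, norm_mul, hnorm, Complex.norm_I, mul_one, Complex.norm_real,
      Real.norm_eq_abs]
    exact one_div_le_one_div_of_le hc (hψ' x hx)
  have hnG : ∀ x ∈ Icc α β, ‖G x‖ ≤ M / c ^ 2 := by
    intro x hx
    simp only [hG, norm_div, norm_mul, hnorm, Complex.norm_I, mul_one, one_mul, norm_pow,
      Complex.norm_real, Real.norm_eq_abs]
    have := hψ'' x hx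
    have := hψ' x hx
    have : 0 ≤ M := (abs_nonneg _).trans (hψ'' x hx)
    gcongr
  have hIG : ‖∫ x in α..β, G x‖ ≤ M / c ^ 2 * |β - α| :=
    intervalIntegral.norm_integral_le_of_norm_le_const fun x hx => by
      rw [uIoc_of_le hαβ] at hx
      exact hnG x (Ioc_subset_Icc_self hx)
  rw [abs_of_nonneg (by linarith)] at hIG
  change ‖∫ x in α..β, e x‖ ≤ _
  rw [hsum]
  have hA := norm_sub_le (F β) (F α)
  have hB := norm_add_le (F β - F α) (∫ x in α..β, G x)
  have hC := hnF β ⟨hαβ, le_rfl⟩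
  have hD := hnF α ⟨le_rfl, hαβ⟩
  have e1 : 2 / c = 1 / c + 1 / c := by ring
  have e2 : M * (β - α) / c ^ 2 = M / c ^ 2 * (β - α) := by ring
  rw [e1, e2]
  linarith

/-- An affine function that is not small somewhere is small only on a short interval. -/
theorem exists_interval_of_affine_small {U V η τ : ℝ} (hη : 0 < η) (hτ : 0 < τ) (hτη : 2 * τ ≤ η)
    (h : η ≤ max |U| |V|) :
    ∃ p q : ℝ, 1 / 4 ≤ p ∧ p ≤ q ∧ q ≤ 3 / 4 ∧ q - p ≤ 4 * τ / η ∧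
      (p = 1 / 4 ∨ ∀ y ∈ Icc (1 / 4) p, τ ≤ |U * y + V|) ∧
      (q = 3 / 4 ∨ ∀ y ∈ Icc q (3 / 4), τ ≤ |U * y + V|) := by
  by_cases hU : η / 2 ≤ |U|
  · have hU0 : 0 < |U| := by linarith
    have hUne : U ≠ 0 := abs_pos.mp hU0
    set z := -V / U with hz
    set r := τ / |U| with hr
    have hr0 : 0 < r := by positivity
    have hrle : 2 * r ≤ 4 * τ / η := by
      have : r ≤ τ / (η / 2) := by rw [hr]; gcongr
      have e : 4 * τ / η = 2 * (τ / (η / 2)) := by field_simp; norm_num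
      linarith
    have hfar : ∀ y, r ≤ |y - z| → τ ≤ |U * y + V| := by
      intro y hy
      have e : U * y + V = U * (y - z) := by rw [hz]; field_simp; ring
      rw [e, abs_mul]
      calc τ = |U| * r := by rw [hr]; field_simp
        _ ≤ _ := by gcongr
    refine ⟨max (1 / 4) (min (3 / 4) (z - r)), max (1 / 4) (min (3 / 4) (z + r)),
      le_max_left _ _, by gcongr; linarith, by
        refine max_le (by norm_num) (min_le_left _ _), ?_, ?_, ?_⟩
    · refine le_trans ?_ hrle
      rcases max_cases (1 / 4) (min (3 / 4) (z - r)) with h1 | h1 <;>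
      rcases max_cases (1 / 4) (min (3 / 4) (z + r)) with h2 | h2 <;>
      rcases min_cases (3 / 4) (z - r) with h3 | h3 <;>
      rcases min_cases (3 / 4) (z + r) with h4 | h4 <;> linarith
    · rcases max_cases (1 / 4) (min (3 / 4) (z - r)) with h1 | h1
      · exact Or.inl h1.1
      · right
        intro y hy
        rw [h1.1] at hy
        refine hfar y ?_
        have := hy.2.trans (min_le_right _ _)
        rw [abs_of_nonpos (by linarith)]; linarith
    · by_cases h1 : 3 / 4 ≤ z + r
      · left
        rw [min_eq_left h1]; norm_num
      · right
        push Not at h1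
        intro y hy
        rw [min_eq_right h1.le] at hy
        refine hfar y ?_
        have := (le_max_right _ _).trans hy.1
        rw [abs_of_nonneg (by linarith)]; linarith
  · push Not at hU
    have hV : η ≤ |V| := by
      rcases le_max_iff.mp h with h | h
      · linarith
      · exact h
    refine ⟨1 / 4, 1 / 4, le_rfl, le_rfl, by norm_num, by rw [sub_self]; positivity, Or.inl rfl,
      Or.inr ?_⟩
    intro y hy
    have h1 : |V| ≤ |U * y + V| + |U * y| := by
      have := abs_sub (U * y + V) (U * y)
      rwa [add_sub_cancel_left] at this
    have h2 : |U * y| ≤ η / 2 * 1 := by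
      rw [abs_mul, abs_of_nonneg (by linarith [hy.1] : (0:ℝ) ≤ y)]
      have := hy.2
      have := hy.1
      gcongr
      linarith
    linarith

/-- Oscillation on an interval where the two denominators `C₁ y + D₁` and `C₂ y + D₂` of a
difference of Möbius maps stay apart. -/
theorem norm_integral_exp_mobius_le {C₁ D₁ C₂ D₂ D₀ K τ Ω p q : ℝ} {ψ : ℝ → ℝ}
    (hD₀ : 0 < D₀) (hK : 1 ≤ K) (hC₁ : 0 ≤ C₁) (hCD₁ : C₁ ≤ D₁) (hC₂ : 0 ≤ C₂) (hCD₂ : C₂ ≤ D₂)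
    (hD₁ : D₀ ≤ D₁) (hD₁' : D₁ ≤ K * D₀) (hD₂ : D₀ ≤ D₂) (hD₂' : D₂ ≤ K * D₀)
    (hτ : 0 < τ) (hτ1 : τ ≤ 1) (hΩ : Ω ≠ 0) (hp : 1 / 4 ≤ p) (hpq : p ≤ q) (hq : q ≤ 3 / 4)
    (hψ : ∀ y ∈ Icc (1 / 4) (3 / 4 : ℝ),
      HasDerivAt ψ (Ω * (1 / (C₁ * y + D₁) ^ 2 - 1 / (C₂ * y + D₂) ^ 2)) y)
    (hsep : ∀ y ∈ Icc p q, τ * D₀ ≤ |(C₂ - C₁) * y + (D₂ - D₁)|) :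
    ‖∫ y in p..q, Complex.exp (ψ y * Complex.I)‖ ≤ 144 * K ^ 8 / (|Ω| / D₀ ^ 2 * τ ^ 2) := by
  set Λ := |Ω| / D₀ ^ 2 with hΛ
  have hΛ0 : 0 < Λ := by positivity
  have hy0 : ∀ y ∈ Icc p q, 0 ≤ y ∧ y ≤ 1 := fun y hy =>
    ⟨by linarith [hy.1], by linarith [hy.2]⟩
  have hden : ∀ {C D y : ℝ}, 0 ≤ C → C ≤ D → D₀ ≤ D → D ≤ K * D₀ → 0 ≤ y → y ≤ 1 →
      D₀ ≤ C * y + D ∧ C * y + D ≤ 2 * K * D₀ ∧ C ≤ C * y + D := by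
    intro C D y h1 h2 h3 h4 h5 h6
    have ha : 0 ≤ C * y := by positivity
    have hb : C * y ≤ C * 1 := by gcongr
    exact ⟨by linarith, by linarith, by linarith⟩
  have key := norm_integral_exp_le_of_le_abs_deriv (ψ := ψ)
    (ψ' := fun y => Ω * (1 / (C₁ * y + D₁) ^ 2 - 1 / (C₂ * y + D₂) ^ 2))
    (ψ'' := fun y => Ω * (-(2 * C₁) / (C₁ * y + D₁) ^ 3 + 2 * C₂ / (C₂ * y + D₂) ^ 3))
    (α := p) (β := q) (c := Λ * τ / (8 * K ^ 4)) (M := 4 * Λ) hpq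
    (fun x hx => hψ x ⟨hp.trans hx.1, hx.2.trans hq⟩) ?_ ?_ (by positivity) ?_ ?_
  · refine key.trans ?_
    have h1 : 4 * Λ * (q - p) ≤ 4 * Λ * (1 / 2) := by gcongr; linarith
    have h2 : 4 * Λ * (q - p) / (Λ * τ / (8 * K ^ 4)) ^ 2 ≤
        4 * Λ * (1 / 2) / (Λ * τ / (8 * K ^ 4)) ^ 2 := by gcongr
    have h3 : 4 * Λ * (1 / 2) / (Λ * τ / (8 * K ^ 4)) ^ 2 = 128 * (K ^ 8 / (Λ * τ ^ 2)) := by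
      field_simp; norm_num
    have h4 : 2 / (Λ * τ / (8 * K ^ 4)) = 16 * (K ^ 4 * τ / (Λ * τ ^ 2)) := by
      field_simp; norm_num
    have h5 : K ^ 4 * τ / (Λ * τ ^ 2) ≤ K ^ 8 / (Λ * τ ^ 2) := by
      gcongr
      calc K ^ 4 * τ ≤ K ^ 4 * 1 := by gcongr
        _ = K ^ 4 := mul_one _
        _ ≤ K ^ 8 := pow_le_pow_right₀ hK (by norm_num)
    have h6 : 144 * K ^ 8 / (Λ * τ ^ 2) = 144 * (K ^ 8 / (Λ * τ ^ 2)) := by ring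
    rw [h4, h6]
    linarith
  · intro y hy
    obtain ⟨hy1, hy2⟩ := hy0 y hy
    have ha := hden hC₁ hCD₁ hD₁ hD₁' hy1 hy2
    have hb := hden hC₂ hCD₂ hD₂ hD₂' hy1 hy2
    have ha0 : C₁ * y + D₁ ≠ 0 := by linarith [ha.1]
    have hb0 : C₂ * y + D₂ ≠ 0 := by linarith [hb.1]
    have d1 : HasDerivAt (fun y => C₁ * y + D₁) C₁ y := by
      simpa using ((hasDerivAt_id y).const_mul C₁).add_const D₁
    have d2 : HasDerivAt (fun y => C₂ * y + D₂) C₂ y := by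
      simpa using ((hasDerivAt_id y).const_mul C₂).add_const D₂
    have h := (((d1.pow 2).fun_inv (pow_ne_zero 2 ha0)).fun_sub
      ((d2.pow 2).fun_inv (pow_ne_zero 2 hb0))).const_mul Ω
    simp only [one_div]
    refine h.congr_deriv ?_
    have e : ∀ u C : ℝ, u ≠ 0 → -((2 : ℕ) * u ^ (2 - 1) * C) / (u ^ 2) ^ 2 = -(2 * C) / u ^ 3 := by
      intro u C hu
      push_cast
      field_simp
    simp only [Pi.pow_apply]
    rw [e _ _ ha0, e _ _ hb0]
    ring
  · intro y hy
    obtain ⟨hy1, hy2⟩ := hy0 y hy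
    have ha := hden hC₁ hCD₁ hD₁ hD₁' hy1 hy2
    have hb := hden hC₂ hCD₂ hD₂ hD₂' hy1 hy2
    have ha0 : C₁ * y + D₁ ≠ 0 := by linarith [ha.1]
    have hb0 : C₂ * y + D₂ ≠ 0 := by linarith [hb.1]
    apply ContinuousAt.continuousWithinAt
    fun_prop (disch := positivity)
  · intro y hy
    obtain ⟨hy1, hy2⟩ := hy0 y hy
    obtain ⟨ha1, ha2, -⟩ := hden hC₁ hCD₁ hD₁ hD₁' hy1 hy2
    obtain ⟨hb1, hb2, -⟩ := hden hC₂ hCD₂ hD₂ hD₂' hy1 hy2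
    have hs := hsep y hy
    have es : (C₂ - C₁) * y + (D₂ - D₁) = (C₂ * y + D₂) - (C₁ * y + D₁) := by ring
    rw [es] at hs
    set u := C₁ * y + D₁
    set v := C₂ * y + D₂
    have hu : 0 < u := by linarith
    have hv : 0 < v := by linarith
    have e : Ω * (1 / u ^ 2 - 1 / v ^ 2) = Ω * ((v - u) * (u + v)) / (u ^ 2 * v ^ 2) := by
      field_simp; ring
    rw [e, abs_div, abs_mul, abs_mul, abs_of_pos (by positivity : 0 < u + v),
      abs_of_pos (by positivity : 0 < u ^ 2 * v ^ 2)]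
    calc Λ * τ / (8 * K ^ 4)
        = |Ω| * (τ * D₀ * (D₀ + D₀)) / ((2 * K * D₀) ^ 2 * (2 * K * D₀) ^ 2) := by
          rw [hΛ]; field_simp; norm_num
      _ ≤ _ := by gcongr
  · intro y hy
    obtain ⟨hy1, hy2⟩ := hy0 y hy
    obtain ⟨ha1, -, ha3⟩ := hden hC₁ hCD₁ hD₁ hD₁' hy1 hy2
    obtain ⟨hb1, -, hb3⟩ := hden hC₂ hCD₂ hD₂ hD₂' hy1 hy2
    have hterm : ∀ {C u : ℝ}, 0 ≤ C → C ≤ u → D₀ ≤ u → 0 ≤ 2 * C / u ^ 3 ∧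
        2 * C / u ^ 3 ≤ 2 / D₀ ^ 2 := by
      intro C u h1 h2 h3
      have hu : 0 < u := by linarith
      refine ⟨by positivity, ?_⟩
      calc 2 * C / u ^ 3 ≤ 2 * u / u ^ 3 := by gcongr
        _ = 2 / u ^ 2 := by field_simp
        _ ≤ 2 / D₀ ^ 2 := by gcongr
    have h1 := hterm hC₁ ha3 ha1
    have h2 := hterm hC₂ hb3 hb1
    rw [abs_mul]
    have e : 4 * Λ = |Ω| * (4 / D₀ ^ 2) := by rw [hΛ]; ring
    rw [e]
    gcongr
    have e2 : 4 / D₀ ^ 2 = 2 / D₀ ^ 2 + 2 / D₀ ^ 2 := by ring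
    rw [e2, neg_div, abs_le]
    constructor <;> linarith [h1.1, h1.2, h2.1, h2.2]

/-- Oscillation of the difference of two Möbius maps with different denominators. -/
theorem norm_integral_exp_mobius_sub_le {C₁ D₁ C₂ D₂ D₀ K η τ Ω : ℝ} {ψ : ℝ → ℝ}
    (hD₀ : 0 < D₀) (hK : 1 ≤ K) (hC₁ : 0 ≤ C₁) (hCD₁ : C₁ ≤ D₁) (hC₂ : 0 ≤ C₂) (hCD₂ : C₂ ≤ D₂)
    (hD₁ : D₀ ≤ D₁) (hD₁' : D₁ ≤ K * D₀) (hD₂ : D₀ ≤ D₂) (hD₂' : D₂ ≤ K * D₀)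
    (hη : 0 < η) (hτ : 0 < τ) (hτ1 : τ ≤ 1) (hτη : 2 * τ ≤ η) (hΩ : Ω ≠ 0)
    (hψ : ∀ y ∈ Icc (1 / 4) (3 / 4 : ℝ),
      HasDerivAt ψ (Ω * (1 / (C₁ * y + D₁) ^ 2 - 1 / (C₂ * y + D₂) ^ 2)) y)
    (hsep : η * D₀ ≤ max |C₂ - C₁| |D₂ - D₁|) :
    ‖∫ y in (1 / 4 : ℝ)..(3 / 4), Complex.exp (ψ y * Complex.I)‖ ≤
      4 * τ / η + 288 * K ^ 8 / (|Ω| / D₀ ^ 2 * τ ^ 2) := by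
  obtain ⟨p, q, hp, hpq, hq, hlen, hl, hr⟩ := exists_interval_of_affine_small
    (U := C₂ - C₁) (V := D₂ - D₁) (η := η * D₀) (τ := τ * D₀) (by positivity) (by positivity)
    (by nlinarith) hsep
  have hlen' : q - p ≤ 4 * τ / η := by
    refine hlen.trans_eq ?_
    field_simp
  set B := 144 * K ^ 8 / (|Ω| / D₀ ^ 2 * τ ^ 2) with hB
  have hB0 : 0 ≤ B := by positivity
  have hInt : ∀ {x y : ℝ}, 1 / 4 ≤ x → x ≤ y → y ≤ 3 / 4 →
      IntervalIntegrable (fun y => Complex.exp (ψ y * Complex.I)) volume x y := by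
    intro x y hx hxy hy
    refine ContinuousOn.intervalIntegrable ?_
    rw [uIcc_of_le hxy]
    intro z hz
    have := (hψ z ⟨hx.trans hz.1, hz.2.trans hy⟩).ofReal_comp.continuousAt
    exact ((this.mul continuousAt_const).cexp).continuousWithinAt
  have h1 : ‖∫ y in (1 / 4 : ℝ)..p, Complex.exp (ψ y * Complex.I)‖ ≤ B := by
    rcases hl with hl | hl
    · rw [hl, intervalIntegral.integral_same, norm_zero]; exact hB0
    · exact norm_integral_exp_mobius_le hD₀ hK hC₁ hCD₁ hC₂ hCD₂ hD₁ hD₁' hD₂ hD₂' hτ hτ1 hΩ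
        le_rfl hp (hpq.trans hq) hψ hl
  have h2 : ‖∫ y in q..(3 / 4 : ℝ), Complex.exp (ψ y * Complex.I)‖ ≤ B := by
    rcases hr with hr | hr
    · rw [hr, intervalIntegral.integral_same, norm_zero]; exact hB0
    · exact norm_integral_exp_mobius_le hD₀ hK hC₁ hCD₁ hC₂ hCD₂ hD₁ hD₁' hD₂ hD₂' hτ hτ1 hΩ
        (hp.trans hpq) hq le_rfl hψ hr
  have h3 : ‖∫ y in p..q, Complex.exp (ψ y * Complex.I)‖ ≤ 4 * τ / η := by
    have := intervalIntegral.norm_integral_le_of_norm_le_const (a := p) (b := q) (C := 1)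
      (f := fun y => Complex.exp (ψ y * Complex.I))
      (fun x _ => (Complex.norm_exp_ofReal_mul_I _).le)
    rw [abs_of_nonneg (by linarith)] at this
    linarith
  rw [← intervalIntegral.integral_add_adjacent_intervals
      (hInt le_rfl (hp.trans hpq) hq) (hInt (hp.trans hpq) hq le_rfl),
    ← intervalIntegral.integral_add_adjacent_intervals
      (hInt le_rfl hp (hpq.trans hq)) (hInt hp hpq hq)]
  have h4 := norm_add₃_le (a := ∫ y in (1 / 4 : ℝ)..p, Complex.exp (ψ y * Complex.I))
    (b := ∫ y in p..q, Complex.exp (ψ y * Complex.I))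
    (c := ∫ y in q..(3 / 4 : ℝ), Complex.exp (ψ y * Complex.I))
  have e : 288 * K ^ 8 / (|Ω| / D₀ ^ 2 * τ ^ 2) = B + B := by rw [hB]; ring
  rw [e]
  linarith

theorem nint_le_abs_sub (x : ℝ) (n : ℤ) : nint x ≤ |x - n| :=
  ciInf_le ⟨0, by rintro _ ⟨m, rfl⟩; exact abs_nonneg _⟩ n

theorem cos_sq_le_of_le_nint {ρ x : ℝ} (hρ : 0 ≤ ρ) (h : ρ ≤ nint x) :
    cos (π * x) ^ 2 ≤ 1 - 4 * ρ ^ 2 := by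
  have h1 : ρ ≤ |x - round x| := h.trans (nint_le_abs_sub x _)
  have h2 : |x - round x| ≤ 1 / 2 := abs_sub_round x
  set z := |x - round x| with hz
  have e : cos (π * x) ^ 2 = cos (π * z) ^ 2 := by
    have e1 : cos (2 * (π * z)) = cos (2 * (π * x)) := by
      have : 2 * (π * z) = |2 * (π * x) - (round x : ℝ) * (2 * π)| := by
        rw [hz, show 2 * (π * x) - (round x : ℝ) * (2 * π) = 2 * π * (x - round x) by ring,
          abs_mul, abs_of_pos (by positivity : 0 < 2 * π)]
        ring
      rw [this, cos_abs, cos_sub_int_mul_two_pi]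
    rw [cos_sq, cos_sq, e1]
  have hj : 2 / π * (π * z) ≤ sin (π * z) :=
    mul_le_sin (by positivity) (by nlinarith [pi_pos])
  have e2 : 2 / π * (π * z) = 2 * z := by field_simp
  rw [e2] at hj
  rw [e, cos_sq']
  nlinarith

theorem cos_pow_two_mul_eq_sum (K : ℕ) (x : ℝ) :
    ((cos (π * x) ^ (2 * K) : ℝ) : ℂ) = ∑ j ∈ Finset.range (2 * K + 1),
      ((((2 * K).choose j : ℝ) / 4 ^ K : ℝ) : ℂ) *
        Complex.exp ((2 * π * (((j : ℤ) - K : ℤ) : ℝ) * x : ℝ) * Complex.I) := by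
  push_cast
  rw [Complex.cos, div_pow, add_pow, Finset.sum_div]
  refine Finset.sum_congr rfl fun j hj => ?_
  have hj' : j ≤ 2 * K := by simpa [Nat.lt_succ_iff] using hj
  have e : Complex.exp (↑π * ↑x * Complex.I) ^ j * Complex.exp (-(↑π * ↑x) * Complex.I) ^ (2 * K - j)
      = Complex.exp (2 * π * (j - K) * x * Complex.I) := by
    rw [← Complex.exp_nat_mul, ← Complex.exp_nat_mul, ← Complex.exp_add]
    congr 1
    rw [Nat.cast_sub hj']
    push_cast
    ring
  rw [e, pow_mul]
  norm_num
  ring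

/-- Second moment of a Weyl sum whose pairwise correlations are small. -/
theorem integral_norm_sq_weyl_sum_le {ι : Type*} [Fintype ι] [DecidableEq ι] {φ : ι → ℝ → ℝ} {κ : ℝ}
    (hφ : ∀ i, ContinuousOn (φ i) (Icc (1 / 4) (3 / 4))) (k δ : ℝ)
    (h : ∀ i j, i ≠ j →
      ‖∫ y in (1 / 4 : ℝ)..(3 / 4), Complex.exp ((2 * π * k * (φ i y - φ j y) : ℝ) * Complex.I)‖ ≤ κ)
    (hκ : 0 ≤ κ) :
    ∫ y in (1 / 4 : ℝ)..(3 / 4),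
      ‖∑ i, Complex.exp ((2 * π * k * (φ i y - δ) : ℝ) * Complex.I)‖ ^ 2 ≤
      (Fintype.card ι : ℝ) + (Fintype.card ι : ℝ) ^ 2 * κ := by
  have hu : uIcc (1 / 4 : ℝ) (3 / 4) = Icc (1 / 4) (3 / 4) := uIcc_of_le (by norm_num)
  have hsq : ∀ y, ((‖∑ i, Complex.exp ((2 * π * k * (φ i y - δ) : ℝ) * Complex.I)‖ ^ 2 : ℝ) : ℂ) =
      ∑ i, ∑ j, Complex.exp ((2 * π * k * (φ i y - φ j y) : ℝ) * Complex.I) := by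
    intro y
    have := Complex.mul_conj' (∑ i, Complex.exp ((2 * π * k * (φ i y - δ) : ℝ) * Complex.I))
    push_cast at this ⊢
    rw [← this, map_sum, Finset.sum_mul_sum]
    refine Finset.sum_congr rfl fun i _ => Finset.sum_congr rfl fun j _ => ?_
    rw [← Complex.exp_conj, ← Complex.exp_add]
    congr 1
    simp only [map_mul, map_sub, Complex.conj_ofReal, Complex.conj_I, map_ofNat]
    ring
  have hInt : ∀ i j, IntervalIntegrable
      (fun y => Complex.exp ((2 * π * k * (φ i y - φ j y) : ℝ) * Complex.I)) volume (1 / 4)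
        (3 / 4) := by
    intro i j
    refine ContinuousOn.intervalIntegrable ?_
    rw [hu]
    exact Complex.continuous_exp.comp_continuousOn
      ((Complex.continuous_ofReal.comp_continuousOn
        (continuousOn_const.mul ((hφ i).sub (hφ j)))).mul continuousOn_const)
  have hbound : ∀ i j, ‖∫ y in (1 / 4 : ℝ)..(3 / 4),
      Complex.exp ((2 * π * k * (φ i y - φ j y) : ℝ) * Complex.I)‖ ≤
        (if i = j then 1 else 0) + κ := by
    intro i j
    split_ifs with hij
    · have := intervalIntegral.norm_integral_le_of_norm_le_const (a := (1 / 4 : ℝ)) (b := 3 / 4)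
        (C := 1) (f := fun y => Complex.exp ((2 * π * k * (φ i y - φ j y) : ℝ) * Complex.I))
        (fun x _ => (Complex.norm_exp_ofReal_mul_I _).le)
      norm_num at this ⊢
      linarith
    · rw [zero_add]; exact h i j hij
  set F := ∫ y in (1 / 4 : ℝ)..(3 / 4),
      ‖∑ i, Complex.exp ((2 * π * k * (φ i y - δ) : ℝ) * Complex.I)‖ ^ 2 with hF
  have hFc : (F : ℂ) = ∑ i, ∑ j, ∫ y in (1 / 4 : ℝ)..(3 / 4),
      Complex.exp ((2 * π * k * (φ i y - φ j y) : ℝ) * Complex.I) := by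
    rw [hF, ← intervalIntegral.integral_ofReal]
    simp_rw [hsq]
    rw [intervalIntegral.integral_finsetSum]
    · refine Finset.sum_congr rfl fun i _ => ?_
      rw [intervalIntegral.integral_finsetSum]
      exact fun j _ => hInt i j
    · intro i _
      have := IntervalIntegrable.sum Finset.univ fun j _ => hInt i j
      simpa only [Finset.sum_fn] using this
  calc F ≤ ‖(F : ℂ)‖ := by rw [Complex.norm_real]; exact le_abs_self _
    _ ≤ ∑ i : ι, ∑ j : ι, ((if i = j then 1 else 0) + κ) := by
      rw [hFc]
      refine (norm_sum_le _ _).trans (Finset.sum_le_sum fun i _ => ?_)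
      exact (norm_sum_le _ _).trans (Finset.sum_le_sum fun j _ => hbound i j)
    _ = _ := by
      simp [Finset.sum_add_distrib, pow_two, mul_assoc]

/-- If the functions `φ i` have small pairwise correlations, then the set of points at which no
`φ i` comes close to `δ` modulo `1` is small. -/
theorem volume_forall_le_nint_le {ι : Type*} [Fintype ι] [Nonempty ι] {φ : ι → ℝ → ℝ}
    {κ ρ δ : ℝ} {K : ℕ} (hK : 1 ≤ K) (hφ : ∀ i, ContinuousOn (φ i) (Icc (1 / 4) (3 / 4)))
    (h : ∀ k : ℤ, k ≠ 0 → ∀ i j, i ≠ j →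
      ‖∫ y in (1 / 4 : ℝ)..(3 / 4), Complex.exp ((2 * π * k * (φ i y - φ j y) : ℝ) * Complex.I)‖ ≤ κ)
    (hκ : 0 ≤ κ) (hρ : 0 ≤ ρ) (hρK : (1 - 4 * ρ ^ 2) ^ K ≤ 1 / (4 * K)) :
    volume.real {y ∈ Icc (1 / 4) (3 / 4 : ℝ) | ∀ i, ρ ≤ nint (φ i y - δ)} ≤
      16 * K ^ 2 * (1 / Fintype.card ι + κ) := by
  classical
  set N : ℝ := ((Fintype.card ι : ℕ) : ℝ) with hN
  have hN0 : 0 < N := by rw [hN]; exact_mod_cast Fintype.card_pos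
  have hK0 : (0 : ℝ) < K := by exact_mod_cast hK
  set w : ℕ → ℝ := fun j => ((2 * K).choose j : ℝ) / 4 ^ K with hw
  have hw0 : ∀ j, 0 ≤ w j := fun j => by positivity
  have hwsum : ∑ j ∈ Finset.range (2 * K + 1), w j = 1 := by
    rw [hw, ← Finset.sum_div]
    have := Nat.sum_range_choose (2 * K)
    rw [pow_mul] at this
    have h2 : (∑ j ∈ Finset.range (2 * K + 1), ((2 * K).choose j : ℝ)) = 4 ^ K := by
      exact_mod_cast this
    rw [h2]
    field_simp
  have hwK : 1 / (2 * K) ≤ w K := by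
    have := Nat.four_pow_le_two_mul_self_mul_centralBinom K hK
    rw [Nat.centralBinom] at this
    have h2 : (4 : ℝ) ^ K ≤ 2 * K * (2 * K).choose K := by exact_mod_cast this
    rw [hw]
    rw [div_le_div_iff₀ (by positivity) (by positivity)]
    linarith
  set T : ℤ → ℝ → ℂ := fun k y => ∑ i, Complex.exp ((2 * π * (k : ℝ) * (φ i y - δ) : ℝ) * Complex.I)
    with hT
  set S : ℝ → ℝ := fun y => ∑ i, cos (π * (φ i y - δ)) ^ (2 * K) with hS
  set J := (Finset.range (2 * K + 1)).erase K with hJ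
  have hKmem : K ∈ Finset.range (2 * K + 1) := by simp; omega
  have hSexp : ∀ y, ((S y - N * w K : ℝ) : ℂ) = ∑ j ∈ J, (w j : ℂ) * T ((j : ℤ) - K) y := by
    intro y
    have h1 : ((S y : ℝ) : ℂ) = ∑ j ∈ Finset.range (2 * K + 1), (w j : ℂ) * T ((j : ℤ) - K) y := by
      rw [hS, Complex.ofReal_sum]
      simp_rw [cos_pow_two_mul_eq_sum, hT, Finset.mul_sum]
      rw [Finset.sum_comm]
    rw [← Finset.add_sum_erase _ _ hKmem] at h1
    have h2 : T ((K : ℤ) - K) y = N := by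
      simp [hT, hN]
    rw [h2] at h1
    push_cast
    rw [h1]
    ring
  have hSq : ∀ y, (S y - N * w K) ^ 2 ≤ ∑ j ∈ J, w j * ‖T ((j : ℤ) - K) y‖ ^ 2 := by
    intro y
    have h1 : |S y - N * w K| ≤ ∑ j ∈ J, w j * ‖T ((j : ℤ) - K) y‖ := by
      rw [← Real.norm_eq_abs, ← Complex.norm_real, hSexp]
      refine (norm_sum_le _ _).trans (Finset.sum_le_sum fun j _ => ?_)
      rw [norm_mul, Complex.norm_real, Real.norm_of_nonneg (hw0 j)]
    have h2 := Finset.sum_mul_sq_le_sq_mul_sq J (fun j => √(w j))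
      (fun j => √(w j) * ‖T ((j : ℤ) - K) y‖)
    have e1 : ∀ j, √(w j) * (√(w j) * ‖T ((j : ℤ) - K) y‖) = w j * ‖T ((j : ℤ) - K) y‖ := by
      intro j; rw [← mul_assoc, Real.mul_self_sqrt (hw0 j)]
    have e2 : ∀ j, (√(w j) * ‖T ((j : ℤ) - K) y‖) ^ 2 = w j * ‖T ((j : ℤ) - K) y‖ ^ 2 := by
      intro j; rw [mul_pow, Real.sq_sqrt (hw0 j)]
    simp_rw [e1, e2, Real.sq_sqrt (hw0 _)] at h2
    have h3 : ∑ j ∈ J, w j ≤ 1 := by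
      rw [← hwsum]
      exact Finset.sum_le_sum_of_subset_of_nonneg (Finset.erase_subset _ _) fun j _ _ => hw0 j
    calc (S y - N * w K) ^ 2 = |S y - N * w K| ^ 2 := (sq_abs _).symm
      _ ≤ (∑ j ∈ J, w j * ‖T ((j : ℤ) - K) y‖) ^ 2 := by gcongr
      _ ≤ (∑ j ∈ J, w j) * ∑ j ∈ J, w j * ‖T ((j : ℤ) - K) y‖ ^ 2 := h2
      _ ≤ 1 * ∑ j ∈ J, w j * ‖T ((j : ℤ) - K) y‖ ^ 2 := by
        gcongr
      _ = _ := one_mul _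
  have hTc : ∀ k, ContinuousOn (fun y => ‖T k y‖ ^ 2) (Icc (1 / 4) (3 / 4)) := by
    intro k
    refine ((continuousOn_finsetSum _ fun i _ => ?_).norm).pow 2
    exact Complex.continuous_exp.comp_continuousOn
      ((Complex.continuous_ofReal.comp_continuousOn
        (continuousOn_const.mul ((hφ i).sub continuousOn_const))).mul continuousOn_const)
  have hTint : ∀ j ∈ J, ∫ y in Icc (1 / 4) (3 / 4 : ℝ), ‖T ((j : ℤ) - K) y‖ ^ 2 ≤ N + N ^ 2 * κ := by
    intro j hj
    have hjK : j ≠ K := (Finset.mem_erase.mp hj).1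
    rw [integral_Icc_eq_integral_Ioc, ← intervalIntegral.integral_of_le (by norm_num)]
    exact integral_norm_sq_weyl_sum_le hφ _ δ (h ((j : ℤ) - K) (by omega)) hκ
  set H : ℝ → ℝ := fun y => ∑ j ∈ J, w j * ‖T ((j : ℤ) - K) y‖ ^ 2 with hH
  have hH0 : ∀ y, 0 ≤ H y := fun y =>
    Finset.sum_nonneg fun j _ => mul_nonneg (hw0 j) (by positivity)
  have hHi : ∀ j, IntegrableOn (fun y => w j * ‖T ((j : ℤ) - K) y‖ ^ 2) (Icc (1 / 4) (3 / 4)) :=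
    fun j => (continuousOn_const.mul (hTc _)).integrableOn_Icc
  have hHint : ∫ y in Icc (1 / 4) (3 / 4 : ℝ), H y ≤ N + N ^ 2 * κ := by
    rw [hH, integral_finsetSum _ fun j _ => hHi j]
    calc _ ≤ ∑ j ∈ J, w j * (N + N ^ 2 * κ) := by
          refine Finset.sum_le_sum fun j hj => ?_
          rw [integral_const_mul]
          exact mul_le_mul_of_nonneg_left (hTint j hj) (hw0 j)
      _ ≤ ∑ j ∈ Finset.range (2 * K + 1), w j * (N + N ^ 2 * κ) :=
          Finset.sum_le_sum_of_subset_of_nonneg (Finset.erase_subset _ _)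
            fun j _ _ => mul_nonneg (hw0 j) (by positivity)
      _ = _ := by rw [← Finset.sum_mul, hwsum, one_mul]
  set c := N ^ 2 / (16 * K ^ 2) with hc
  have hsub : {y ∈ Icc (1 / 4) (3 / 4 : ℝ) | ∀ i, ρ ≤ nint (φ i y - δ)} ⊆
      {y | c ≤ H y} ∩ Icc (1 / 4) (3 / 4) := by
    rintro y ⟨hy, hyE⟩
    refine ⟨?_, hy⟩
    refine le_trans ?_ (hSq y)
    have h1 : S y ≤ N * (1 / (4 * K)) := by
      calc S y ≤ ∑ _i : ι, 1 / (4 * (K : ℝ)) := by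
            refine Finset.sum_le_sum fun i _ => ?_
            rw [pow_mul]
            refine le_trans ?_ hρK
            have := cos_sq_le_of_le_nint hρ (hyE i)
            gcongr
        _ = _ := by simp [hN]
    have h2 : N * (1 / (4 * K)) ≤ N * w K - S y := by
      have h3 : N * (1 / (2 * K)) ≤ N * w K := by gcongr
      have h4 : N * (1 / (2 * K)) = N * (1 / (4 * K)) + N * (1 / (4 * K)) := by
        field_simp; norm_num
      linarith
    have h3 : (N * (1 / (4 * K))) ^ 2 ≤ (N * w K - S y) ^ 2 := by gcongr
    have h4 : c = (N * (1 / (4 * K))) ^ 2 := by rw [hc]; field_simp; norm_num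
    rw [h4]
    linarith
  have hmarkov := mul_meas_ge_le_integral_of_nonneg
    (μ := volume.restrict (Icc (1 / 4) (3 / 4 : ℝ))) (f := H)
    (Filter.Eventually.of_forall hH0) (integrable_finsetSum _ fun j _ => hHi j) c
  have hvol : volume.real {y ∈ Icc (1 / 4) (3 / 4 : ℝ) | ∀ i, ρ ≤ nint (φ i y - δ)} ≤
      (volume.restrict (Icc (1 / 4) (3 / 4 : ℝ))).real {y | c ≤ H y} := by
    refine ENNReal.toReal_mono (measure_ne_top _ _) ?_
    exact (measure_mono hsub).trans (Measure.le_restrict_apply _ _)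
  have hc0 : 0 < c := by positivity
  have hfin : c * volume.real {y ∈ Icc (1 / 4) (3 / 4 : ℝ) | ∀ i, ρ ≤ nint (φ i y - δ)} ≤
      N + N ^ 2 * κ := by
    refine le_trans ?_ (hmarkov.trans hHint)
    gcongr
  have e : 16 * K ^ 2 * (1 / N + κ) = (N + N ^ 2 * κ) / c := by
    rw [hc]; field_simp
  rw [e, le_div_iff₀ hc0]
  linarith

/-- The partial quotient repeated twice in the continued fraction block encoded by a bit. -/
def blockDigit (s : Bool) : ℤ := if s then 2 else 1

/-- Right action of the block matrix `(1 t; t t² + 1)` on row vectors. -/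
def blockRow (v : ℤ × ℤ) (s : Bool) : ℤ × ℤ :=
  (v.1 + blockDigit s * v.2, blockDigit s * v.1 + (blockDigit s ^ 2 + 1) * v.2)

/-- The Möbius action of the block matrix `(1 t; t t² + 1)`. -/
noncomputable def blockMap (s : Bool) (y : ℝ) : ℝ :=
  (y + blockDigit s) / (blockDigit s * y + (blockDigit s ^ 2 + 1))

/-- Right action of a product of block matrices on row vectors. -/
def wordRow (v : ℤ × ℤ) (l : List Bool) : ℤ × ℤ := l.foldl blockRow v

/-- The Möbius action of a product of block matrices. -/
noncomputable def wordMap (l : List Bool) (y : ℝ) : ℝ := l.foldr blockMap y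

theorem blockDigit_eq (s : Bool) : blockDigit s = 1 ∨ blockDigit s = 2 := by
  cases s <;> simp [blockDigit]

theorem blockMap_mem {s : Bool} {y : ℝ} (hy : y ∈ Icc (1 / 4) (3 / 4 : ℝ)) :
    blockMap s y ∈ Icc (1 / 4) (3 / 4 : ℝ) := by
  obtain ⟨h1, h2⟩ := hy
  rcases blockDigit_eq s with h | h <;> simp only [blockMap, h, mem_Icc] <;> push_cast <;>
    rw [div_le_div_iff₀ (by norm_num) (by linarith), div_le_div_iff₀ (by linarith) (by norm_num)] <;>
    constructor <;> linarith

theorem wordMap_mem {l : List Bool} {y : ℝ} (hy : y ∈ Icc (1 / 4) (3 / 4 : ℝ)) :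
    wordMap l y ∈ Icc (1 / 4) (3 / 4 : ℝ) := by
  induction l with
  | nil => exact hy
  | cons s l ih => exact blockMap_mem ih

theorem wordMap_linear (l : List Bool) {y : ℝ} (hy : y ∈ Icc (1 / 4) (3 / 4 : ℝ)) :
    ∃ q : ℝ, 0 < q ∧ ∀ v : ℤ × ℤ,
      v.1 * wordMap l y + v.2 = ((wordRow v l).1 * y + (wordRow v l).2) / q := by
  induction l with
  | nil => exact ⟨1, one_pos, fun v => by simp [wordMap, wordRow]⟩
  | cons s l ih =>
    obtain ⟨q, hq, h⟩ := ih
    have hw : 1 / 4 ≤ wordMap l y := (wordMap_mem hy).1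
    have hw0 : 0 < blockDigit s * wordMap l y + ((blockDigit s : ℝ) ^ 2 + 1) := by
      rcases blockDigit_eq s with h | h <;> rw [h] <;> push_cast <;> linarith
    refine ⟨q * (blockDigit s * wordMap l y + ((blockDigit s : ℝ) ^ 2 + 1)), by positivity,
      fun v => ?_⟩
    have e := h (blockRow v s)
    change v.1 * blockMap s (wordMap l y) + v.2 =
      ((wordRow (blockRow v s) l).1 * y + (wordRow (blockRow v s) l).2) / _
    rw [← div_div, ← e, blockMap, eq_div_iff hw0.ne', add_mul, mul_assoc,
      div_mul_cancel₀ _ hw0.ne']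
    simp only [blockRow]
    push_cast
    ring

theorem wordRow_bounds (l : List Bool) : ∀ {v : ℤ × ℤ}, 0 ≤ v.1 → v.1 ≤ v.2 →
    0 ≤ (wordRow v l).1 ∧ (wordRow v l).1 ≤ (wordRow v l).2 ∧ v.2 ≤ (wordRow v l).2 ∧
      (wordRow v l).2 ≤ 7 ^ l.length * v.2 := by
  induction l with
  | nil => intro v h1 h2; simpa [wordRow] using ⟨h1, h2⟩
  | cons s l ih =>
    intro v h1 h2
    have hb : 0 ≤ (blockRow v s).1 ∧ (blockRow v s).1 ≤ (blockRow v s).2 ∧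
        v.2 ≤ (blockRow v s).2 ∧ (blockRow v s).2 ≤ 7 * v.2 := by
      rcases blockDigit_eq s with h | h <;> simp only [blockRow, h] <;>
        refine ⟨?_, ?_, ?_, ?_⟩ <;> linarith
    obtain ⟨i1, i2, i3, i4⟩ := ih hb.1 hb.2.1
    refine ⟨i1, i2, hb.2.2.1.trans i3, i4.trans ?_⟩
    rw [List.length_cons, pow_succ, mul_assoc]
    exact mul_le_mul_of_nonneg_left hb.2.2.2 (by positivity)

theorem wordRow_det (l : List Bool) : ∀ u v : ℤ × ℤ,
    (wordRow u l).1 * (wordRow v l).2 - (wordRow u l).2 * (wordRow v l).1 =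
      u.1 * v.2 - u.2 * v.1 := by
  induction l with
  | nil => intro u v; rfl
  | cons s l ih =>
    intro u v
    refine (ih (blockRow u s) (blockRow v s)).trans ?_
    simp only [blockRow]
    ring

theorem wordRow_concat (v : ℤ × ℤ) (l : List Bool) (s : Bool) :
    wordRow v (l ++ [s]) = blockRow (wordRow v l) s := by
  simp [wordRow, List.foldl_append]

/-- Different words of the same length have well separated denominators. -/
theorem wordRow_separated {v : ℤ × ℤ} (h1 : 0 ≤ v.1) (h2 : v.1 ≤ v.2) (l : List Bool) :
    ∀ l' : List Bool, l.length = l'.length → l ≠ l' →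
      v.2 ≤ 9 * 7 ^ l.length * max |(wordRow v l').1 - (wordRow v l).1|
        |(wordRow v l').2 - (wordRow v l).2| := by
  induction l using List.reverseRecOn with
  | nil =>
    intro l' hl hne
    exact absurd (List.eq_nil_of_length_eq_zero hl.symm).symm hne
  | append_singleton l s ih =>
    intro l' hl hne
    rcases List.eq_nil_or_concat l' with rfl | ⟨l₁, s', rfl⟩
    · simp at hl
    rw [List.concat_eq_append] at hl hne ⊢
    rw [wordRow_concat, wordRow_concat, List.length_append, List.length_singleton, pow_succ]
    have hlen : l.length = l₁.length := by simpa using hl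
    obtain ⟨a1, a2, a3, -⟩ := wordRow_bounds l h1 h2
    obtain ⟨b1, b2, b3, -⟩ := wordRow_bounds l₁ h1 h2
    by_cases hs : s = s'
    · subst hs
      have hne' : l ≠ l₁ := fun h => hne (by rw [h])
      have := ih l₁ hlen hne'
      set x := wordRow v l
      set x' := wordRow v l₁
      have key : max |x'.1 - x.1| |x'.2 - x.2| ≤ 7 *
          max |(blockRow x' s).1 - (blockRow x s).1| |(blockRow x' s).2 - (blockRow x s).2| := by
        set m := max |(blockRow x' s).1 - (blockRow x s).1|
          |(blockRow x' s).2 - (blockRow x s).2| with hm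
        have m1 := abs_le.mp (le_max_left |(blockRow x' s).1 - (blockRow x s).1|
          |(blockRow x' s).2 - (blockRow x s).2|)
        have m2 := abs_le.mp (le_max_right |(blockRow x' s).1 - (blockRow x s).1|
          |(blockRow x' s).2 - (blockRow x s).2|)
        rw [← hm] at m1 m2
        rw [max_le_iff, abs_le, abs_le]
        rcases blockDigit_eq s with h | h <;> simp only [blockRow, h] at m1 m2 <;>
          refine ⟨⟨?_, ?_⟩, ?_, ?_⟩ <;> linarith [m1.1, m1.2, m2.1, m2.2]
      calc v.2 ≤ 9 * 7 ^ l.length * max |x'.1 - x.1| |x'.2 - x.2| := this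
        _ ≤ 9 * 7 ^ l.length * (7 * _) := mul_le_mul_of_nonneg_left key (by positivity)
        _ = _ := by ring
    · set x := wordRow v l
      set x' := wordRow v l₁
      have key : v.2 ≤ 20 *
          max |(blockRow x' s').1 - (blockRow x s).1| |(blockRow x' s').2 - (blockRow x s).2| := by
        set m := max |(blockRow x' s').1 - (blockRow x s).1|
          |(blockRow x' s').2 - (blockRow x s).2| with hm
        have m1 := abs_le.mp (le_max_left |(blockRow x' s').1 - (blockRow x s).1|
          |(blockRow x' s').2 - (blockRow x s).2|)
        have m2 := abs_le.mp (le_max_right |(blockRow x' s').1 - (blockRow x s).1|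
          |(blockRow x' s').2 - (blockRow x s).2|)
        rw [← hm] at m1 m2
        cases s <;> cases s' <;> simp [blockRow, blockDigit] at m1 m2 hs <;>
          linarith [m1.1, m1.2, m2.1, m2.2]
      have hp : (1 : ℤ) ≤ 7 ^ l.length := one_le_pow₀ (by norm_num)
      have hm0 : 0 ≤ max |(blockRow x' s').1 - (blockRow x s).1|
        |(blockRow x' s').2 - (blockRow x s).2| := le_max_of_le_left (abs_nonneg _)
      calc v.2 ≤ 20 * _ := key
        _ ≤ (9 * (7 ^ l.length * 7)) * _ := mul_le_mul_of_nonneg_right (by linarith) hm0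

/-- Approximations to `wordMap l y` are controlled by approximations to `y`. -/
theorem wordMap_badly_approximable {M T y : ℝ} (hM : 182 ≤ M) (hy : y ∈ Icc (1 / 4) (3 / 4 : ℝ))
    (l : List Bool) : ∀ {v : ℤ × ℤ}, 0 ≤ v.1 → v.1 ≤ v.2 → 0 < v.2 →
      (∀ a b : ℤ, 0 < b → (b : ℝ) * (wordRow v l).2 ≤ T → 1 ≤ M * (b * |b * y - a|)) →
      ∀ {a b : ℤ}, 0 ≤ a → a ≤ b → 0 < b → ((v.1 * a + v.2 * b : ℤ) : ℝ) ≤ T →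
        v.1 * wordMap l y + v.2 ≤
          2 * M * (|b * wordMap l y - a| * ((v.1 * a + v.2 * b : ℤ) : ℝ)) := by
  induction l with
  | nil =>
    intro v hv1 hv2 hv3 h a b ha hab hb hT
    change v.1 * y + v.2 ≤ 2 * M * (|b * y - a| * ((v.1 * a + v.2 * b : ℤ) : ℝ))
    have hle : (v.2 : ℝ) * b ≤ ((v.1 * a + v.2 * b : ℤ) : ℝ) := by
      have : v.2 * b ≤ v.1 * a + v.2 * b := by have := mul_nonneg hv1 ha; linarith
      exact_mod_cast this
    have h1 := h a b hb (by
      change (b : ℝ) * v.2 ≤ T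
      linarith)
    have hv2' : (v.1 : ℝ) ≤ v.2 := by exact_mod_cast hv2
    have hv1' : (0 : ℝ) ≤ v.1 := by exact_mod_cast hv1
    have hv3' : (0 : ℝ) < v.2 := by exact_mod_cast hv3
    have h2 : v.1 * y ≤ v.2 * 1 := by
      have := hy.1; have := hy.2
      gcongr; linarith
    calc v.1 * y + v.2 ≤ 2 * v.2 * 1 := by linarith
      _ ≤ 2 * v.2 * (M * (b * |b * y - a|)) := by gcongr
      _ = 2 * M * (|b * y - a| * (v.2 * b)) := by ring
      _ ≤ _ := by gcongr
  | cons s l ih =>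
    intro v hv1 hv2 hv3 h a b ha hab hb hT
    set w := wordMap l y with hw
    have hwm : w ∈ Icc (1 / 4) (3 / 4 : ℝ) := wordMap_mem hy
    obtain ⟨hw1, hw2⟩ := hwm
    change v.1 * blockMap s w + v.2 ≤
      2 * M * (|b * blockMap s w - a| * ((v.1 * a + v.2 * b : ℤ) : ℝ))
    set t := blockDigit s with ht
    set a' := (t ^ 2 + 1) * a - t * b with ha'
    set b' := b - t * a with hb'
    have hq : 0 < (t : ℝ) * w + (t ^ 2 + 1) ∧ (t : ℝ) * w + (t ^ 2 + 1) ≤ 6.5 := by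
      rcases blockDigit_eq s with h | h <;> rw [← ht] at h <;> rw [h] <;> push_cast <;>
        constructor <;> linarith
    set q := (t : ℝ) * w + (t ^ 2 + 1) with hqdef
    have e1 : b * blockMap s w - a = (b' * w - a') / q := by
      rw [eq_div_iff hq.1.ne', blockMap, ← ht, ← hqdef, sub_mul, mul_assoc, div_mul_cancel₀ _ hq.1.ne']
      rw [ha', hb', hqdef]
      push_cast
      ring
    have e2 : v.1 * a + v.2 * b = (blockRow v s).1 * a' + (blockRow v s).2 * b' := by
      simp only [blockRow, ← ht, ha', hb']
      ring
    have e3 : v.1 * blockMap s w + v.2 = ((blockRow v s).1 * w + (blockRow v s).2) / q := by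
      rw [eq_div_iff hq.1.ne', blockMap, ← ht, ← hqdef, add_mul, mul_assoc, div_mul_cancel₀ _ hq.1.ne']
      simp only [blockRow, ← ht]
      rw [hqdef]
      push_cast
      ring
    by_cases hin : 0 ≤ a' ∧ a' ≤ b' ∧ 0 < b'
    · obtain ⟨i1, i2, i3⟩ := hin
      have hb : 0 ≤ (blockRow v s).1 ∧ (blockRow v s).1 ≤ (blockRow v s).2 ∧
          0 < (blockRow v s).2 := by
        rcases blockDigit_eq s with h | h <;> simp only [blockRow, h] <;>
          refine ⟨?_, ?_, ?_⟩ <;> linarith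
      have := ih hb.1 hb.2.1 hb.2.2 h i1 i2 i3 (by rw [← e2]; exact hT)
      rw [e3, e1, abs_div, abs_of_pos hq.1, e2, div_le_iff₀ hq.1]
      refine this.trans_eq ?_
      have hq0 := hq.1.ne'
      generalize q = q at hq0
      field_simp
    · have hfar : (b : ℝ) / 28 ≤ |b' * w - a'| := by
        have ea : a = a' + t * b' := by rw [ha', hb']; ring
        have eb : b = t * a' + (t ^ 2 + 1) * b' := by rw [ha', hb']; ring
        have ea0 : (0 : ℝ) ≤ a' + t * b' := by exact_mod_cast ea ▸ ha
        have eb0 : (b : ℝ) = t * a' + (t ^ 2 + 1) * b' := by exact_mod_cast eb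
        have hbpos : (0 : ℝ) < b := by exact_mod_cast hb
        have ht2 : (t : ℝ) = 1 ∨ (t : ℝ) = 2 := by
          rcases blockDigit_eq s with h | h
          · left; rw [ht, h]; norm_num
          · right; rw [ht, h]; norm_num
        by_cases hb0 : 0 < b'
        · have hb0' : (0 : ℝ) < b' := by exact_mod_cast hb0
          by_cases ha0 : 0 ≤ a'
          · have : b' < a' := by
              by_contra hcon
              exact hin ⟨ha0, not_lt.mp hcon, hb0⟩
            have hlt : (b' : ℝ) < a' := by exact_mod_cast this
            have h1 : (b' : ℝ) * w ≤ a' * (3 / 4) := by gcongr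
            rw [abs_of_nonpos (by linarith)]
            rcases ht2 with h | h <;> rw [h] at eb0 <;> linarith
          · have hlt : (a' : ℝ) < 0 := by exact_mod_cast not_le.mp ha0
            have h1 : (b' : ℝ) * (1 / 4) ≤ b' * w := by gcongr
            rw [abs_of_nonneg (by linarith)]
            rcases ht2 with h | h <;> rw [h] at eb0 <;> linarith
        · have hb0' : (b' : ℝ) ≤ 0 := by exact_mod_cast not_lt.mp hb0
          have h1 : (b' : ℝ) * w ≤ 0 := mul_nonpos_of_nonpos_of_nonneg hb0' (by linarith)
          have ha0 : (0 : ℝ) ≤ a' := by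
            rcases ht2 with h | h <;> rw [h] at ea0 <;> linarith
          rw [abs_of_nonpos (by linarith)]
          rcases ht2 with h | h <;> rw [h] at eb0 <;> linarith
      have hb1 : (1 : ℝ) ≤ b := by exact_mod_cast hb
      have hfar' : (b : ℝ) / 182 ≤ |b * blockMap s w - a| := by
        rw [e1, abs_div, abs_of_pos hq.1, le_div_iff₀ hq.1]
        have : (b : ℝ) / 182 * q ≤ b / 182 * 6.5 := by gcongr; exact hq.2
        linarith
      have hv2' : (v.1 : ℝ) ≤ v.2 := by exact_mod_cast hv2
      have hv1' : (0 : ℝ) ≤ v.1 := by exact_mod_cast hv1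
      have hv3' : (0 : ℝ) < v.2 := by exact_mod_cast hv3
      have hm : blockMap s w ∈ Icc (1 / 4) (3 / 4 : ℝ) := blockMap_mem ⟨hw1, hw2⟩
      have h2 : v.1 * blockMap s w ≤ v.2 * 1 := by
        have := hm.1; have := hm.2
        gcongr; linarith
      have hle : (v.2 : ℝ) * b ≤ ((v.1 * a + v.2 * b : ℤ) : ℝ) := by
        have : v.2 * b ≤ v.1 * a + v.2 * b := by have := mul_nonneg hv1 ha; linarith
        exact_mod_cast this
      have hbb : (1 : ℝ) ≤ b * b := by nlinarith
      calc v.1 * blockMap s w + v.2 ≤ 2 * v.2 * 1 := by linarith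
        _ ≤ 2 * v.2 * (b * b) := by gcongr
        _ = 2 * 182 * (b / 182 * (v.2 * b)) := by ring
        _ ≤ _ := by gcongr

/-- A unimodular matrix `(P B; Q D)` which maps `[0, 1]` into the interval `[a, a + ℓ]`, with `Q` of
order `ℓ^(-1/2)` and `D / Q` of order `R`. -/
structure IsPrefix (R : ℕ) (a ℓ : ℝ) (P Q B D : ℤ) : Prop where
  pos : 0 < Q
  det : P * D - B * Q = 1
  le_D : 24 * R * Q ≤ D
  D_le : D ≤ (24 * R + 1) * Q
  lt_len : 1 < 8 * R * ℓ * (Q : ℝ) ^ 2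
  len_le : (Q : ℝ) ^ 2 * ℓ ≤ 8 * R ^ 3
  left_le : a + ℓ / 3 ≤ P / Q
  le_right : (P : ℝ) / Q ≤ a + 2 * ℓ / 3

theorem GoodInterval.exists_isPrefix {R : ℕ} (hR : 8 ≤ R) {a ℓ : ℝ} (hℓ : 0 < ℓ) (hℓ1 : ℓ ≤ 1)
    (h : GoodInterval R a ℓ) : ∃ P Q B D : ℤ, IsPrefix R a ℓ P Q B D := by
  have hR8 : (8 : ℝ) ≤ R := by exact_mod_cast hR
  set X : ℝ := 8 * R ^ 3 / ℓ with hX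
  have hX1 : 1 ≤ X := by
    rw [hX, le_div_iff₀ hℓ]
    have : (1 : ℝ) ≤ R ^ 3 := one_le_pow₀ (by linarith)
    linarith
  set N := ⌊√X⌋₊ with hN
  have hN1 : 1 ≤ N := by
    rw [hN, Nat.one_le_floor_iff, Real.one_le_sqrt]; exact hX1
  have hNle : (N : ℝ) ^ 2 ≤ X := by
    rw [← Real.le_sqrt (by positivity) (by positivity)]
    exact Nat.floor_le (Real.sqrt_nonneg _)
  have hNlt : X < ((N : ℝ) + 1) ^ 2 := by
    rw [← Real.sqrt_lt' (by positivity)]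
    exact Nat.lt_floor_add_one _
  obtain ⟨r, hr1, hr2⟩ := Real.exists_rat_abs_sub_le_and_den_le (a + ℓ / 2) hN1
  set P := r.num with hP
  set Q : ℤ := ((r.den : ℕ) : ℤ) with hQ
  have hQ0 : 0 < Q := by rw [hQ]; exact_mod_cast r.den_pos
  have hQ0' : (0 : ℝ) < Q := by exact_mod_cast hQ0
  have hrPQ : (r : ℝ) = P / Q := by
    rw [hP, hQ]; exact_mod_cast (Rat.num_div_den r).symm
  have hQN : (Q : ℝ) ≤ N := by rw [hQ]; exact_mod_cast hr2
  have hQ2 : (Q : ℝ) ^ 2 * ℓ ≤ 8 * R ^ 3 := by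
    have : (Q : ℝ) ^ 2 ≤ X := le_trans (by gcongr) hNle
    rwa [hX, le_div_iff₀ hℓ] at this
  have hr1' : |a + ℓ / 2 - P / Q| ≤ 1 / ((N + 1) * Q) := by
    rw [← hrPQ, hQ, Int.cast_natCast]; exact hr1
  have hXℓ : X * ℓ = 8 * R ^ 3 := by rw [hX]; field_simp
  have hlen : 1 < 8 * R * ℓ * (Q : ℝ) ^ 2 := by
    by_cases hs : 2 * R * ℓ * (Q : ℝ) ^ 2 ≤ 1
    · have h1 := h P Q hQ0 hs (a + ℓ / 2) ⟨by linarith, by linarith⟩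
      have h2 : |Q * (a + ℓ / 2) - P| ≤ 1 / (N + 1) := by
        have e : Q * (a + ℓ / 2) - P = Q * (a + ℓ / 2 - P / Q) := by field_simp
        rw [e, abs_mul, abs_of_pos hQ0']
        calc Q * |a + ℓ / 2 - P / Q| ≤ Q * (1 / ((N + 1) * Q)) := by gcongr
          _ = 1 / (N + 1) := by field_simp
      have h3 : 1 ≤ 8 * (R : ℝ) ^ 2 * (Q * (1 / (N + 1))) := h1.trans (by gcongr)
      have h4 : (N : ℝ) + 1 ≤ 8 * R ^ 2 * Q := by
        have e : 8 * (R : ℝ) ^ 2 * (Q * (1 / (N + 1))) = 8 * R ^ 2 * Q / (N + 1) := by ring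
        rwa [e, le_div_iff₀ (by positivity), one_mul] at h3
      have h5 : ((N : ℝ) + 1) ^ 2 ≤ (8 * R ^ 2 * Q) ^ 2 := by gcongr
      have h6 : X * ℓ < (8 * R ^ 2 * Q) ^ 2 * ℓ := by gcongr; linarith
      rw [hXℓ] at h6
      have h7 : 8 * (R : ℝ) ^ 3 * 1 < 8 * R ^ 3 * (8 * R * ℓ * (Q : ℝ) ^ 2) := by
        calc 8 * (R : ℝ) ^ 3 * 1 = 8 * R ^ 3 := mul_one _
          _ < _ := h6
          _ = _ := by ring
      exact lt_of_mul_lt_mul_left h7 (by positivity)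
    · push Not at hs
      linarith
  have hdist : |a + ℓ / 2 - P / Q| ≤ ℓ / 6 := by
    refine hr1'.trans ?_
    have h1 : ((R : ℝ) / ℓ) ^ 2 ≤ ((N + 1) * Q) ^ 2 := by
      calc ((R : ℝ) / ℓ) ^ 2 = X / (8 * R * ℓ) * 1 := by rw [hX]; field_simp
        _ ≤ X / (8 * R * ℓ) * (8 * R * ℓ * (Q : ℝ) ^ 2) := by gcongr
        _ = X * (Q : ℝ) ^ 2 := by field_simp
        _ ≤ (N + 1) ^ 2 * (Q : ℝ) ^ 2 := by gcongr
        _ = _ := by ring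
    have h2 : (R : ℝ) / ℓ ≤ (N + 1) * Q :=
      le_of_sq_le_sq h1 (by positivity)
    calc 1 / ((N + 1) * (Q : ℝ)) ≤ 1 / (R / ℓ) := by gcongr
      _ = ℓ / R := by field_simp
      _ ≤ ℓ / 6 := by gcongr; linarith
  have hcop : IsCoprime P Q := by
    rw [hP, hQ, Int.isCoprime_iff_gcd_eq_one]
    exact r.reduced
  obtain ⟨u, v, huv⟩ := hcop
  have hmod := Int.emod_add_mul_ediv u Q
  have hm0 := Int.emod_nonneg u hQ0.ne'
  have hm1 := Int.emod_lt_of_pos u hQ0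
  rw [abs_le] at hdist
  refine ⟨P, Q, -v + (24 * R - u / Q) * P, u % Q + 24 * R * Q, ⟨hQ0, ?_, by linarith, by linarith,
    hlen, hQ2, by linarith, by linarith⟩⟩
  have : u % Q = u - Q * (u / Q) := by linarith
  rw [this]
  linear_combination huv

section IsPrefix

variable {R : ℕ} {a ℓ : ℝ} {P Q B D : ℤ}

theorem IsPrefix.Q_le_D (hg : IsPrefix R a ℓ P Q B D) (hR : 1 ≤ R) : Q ≤ D := by
  have h1 : (1 : ℤ) ≤ R := by exact_mod_cast hR
  have := hg.le_D
  have h2 := mul_le_mul_of_nonneg_right h1 hg.pos.le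
  have := hg.pos
  linarith

theorem IsPrefix.map_sub_eq (hg : IsPrefix R a ℓ P Q B D) {w : ℝ} (hw : 0 < Q * w + D) :
    (P * w + B) / (Q * w + D) = (P : ℝ) / Q - 1 / (Q * (Q * w + D)) := by
  have hQ : (0 : ℝ) < Q := by exact_mod_cast hg.pos
  have hdet : (P : ℝ) * D - B * Q = 1 := by exact_mod_cast hg.det
  rw [div_sub_div _ _ hQ.ne' (by positivity), div_eq_div_iff hw.ne' (by positivity)]
  linear_combination (-(Q * (Q * w + D)) : ℝ) * hdet

theorem IsPrefix.map_mem (hg : IsPrefix R a ℓ P Q B D) (hR : 1 ≤ R) {w : ℝ} (hw : 0 ≤ w) :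
    (P * w + B) / (Q * w + D) ∈ Icc a (a + ℓ) := by
  have hQ : (0 : ℝ) < Q := by exact_mod_cast hg.pos
  have hR' : (1 : ℝ) ≤ R := by exact_mod_cast hR
  have hD : 24 * R * (Q : ℝ) ≤ D := by exact_mod_cast hg.le_D
  have hD0 : (0 : ℝ) < D := lt_of_lt_of_le (by positivity) hD
  have hw0 : 0 < Q * w + D := by positivity
  rw [hg.map_sub_eq hw0]
  have h1 : 1 / (Q * (Q * w + D)) ≤ ℓ / 3 := by
    rw [div_le_div_iff₀ (by positivity) (by norm_num)]
    have h2 := hg.lt_len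
    have hℓ : 0 < ℓ := by
      by_contra hcon
      push Not at hcon
      have : 8 * R * ℓ * (Q : ℝ) ^ 2 ≤ 0 :=
        mul_nonpos_of_nonpos_of_nonneg (mul_nonpos_of_nonneg_of_nonpos (by positivity) hcon)
          (by positivity)
      linarith
    have h3 : ℓ * (Q * (24 * R * Q)) ≤ ℓ * (Q * (Q * w + D)) := by
      gcongr
      have : 0 ≤ Q * w := by positivity
      linarith
    linarith
  have h2 : 0 < 1 / (Q * (Q * w + D)) := by positivity
  have := hg.left_le
  have := hg.le_right
  constructor <;> linarith

set_option maxHeartbeats 1000000 in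
/-- The image under a prefix matrix of a point which is badly approximable by the fractions in
`[0, 1]` is badly approximable. -/
theorem IsPrefix.badly_approximable (hg : IsPrefix R a ℓ P Q B D) (hR : 4 ≤ R)
    (hI : GoodInterval R a ℓ) {w T : ℝ} (hw : w ∈ Icc (1 / 4) (3 / 4 : ℝ))
    (h : ∀ α β : ℤ, 0 ≤ α → α ≤ β → 0 < β → ((Q * α + D * β : ℤ) : ℝ) ≤ T →
      Q * w + D ≤ 8 * R ^ 2 * (|β * w - α| * ((Q * α + D * β : ℤ) : ℝ)))
    {p S : ℤ} (hS : 0 < S) (hST : S ≤ T) :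
    1 ≤ 8 * R ^ 2 * (S * |S * ((P * w + B) / (Q * w + D)) - p|) := by
  obtain ⟨hw1, hw2⟩ := hw
  have hQ : (0 : ℝ) < Q := by exact_mod_cast hg.pos
  have hR' : (4 : ℝ) ≤ R := by exact_mod_cast hR
  have hD : 24 * R * (Q : ℝ) ≤ D := by exact_mod_cast hg.le_D
  have hD' : (D : ℝ) ≤ (24 * R + 1) * Q := by exact_mod_cast hg.D_le
  have hQD : (Q : ℝ) ≤ D := by exact_mod_cast hg.Q_le_D (by omega)
  have hD0 : (0 : ℝ) < D := by linarith
  have hS0 : (0 : ℝ) < S := by exact_mod_cast hS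
  have hQw : Q * w ≤ Q * 1 := by gcongr; linarith
  have hw0 : 0 < Q * w + D := by positivity
  have hdet : (P : ℝ) * D - B * Q = 1 := by exact_mod_cast hg.det
  set x := (P * w + B) / (Q * w + D) with hx
  have hR2 : 4 * (R : ℝ) ≤ R ^ 2 := by nlinarith
  by_cases h1 : 2 * R * ℓ * (S : ℝ) ^ 2 ≤ 1
  · exact hI p S hS h1 x (hg.map_mem (by omega) (by linarith))
  push Not at h1
  by_cases hSQ : S < Q
  · have hne : P * S ≠ p * Q := by
      intro heq
      have hdvd : Q ∣ S := by
        have hc : IsCoprime Q P := ⟨-B, D, by linarith [hg.det]⟩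
        exact hc.dvd_of_dvd_mul_left ⟨p, by linarith⟩
      exact absurd (Int.le_of_dvd hS hdvd) (not_le.mpr hSQ)
    have h2 := one_le_abs_mul_sub_mul hne
    have hSQ' : (S : ℝ) < Q := by exact_mod_cast hSQ
    have e : Q * (S * x - p) = ((P : ℝ) * S - p * Q) - S / (Q * w + D) := by
      rw [hx, hg.map_sub_eq hw0]; field_simp; ring
    have h3 : S / (Q * w + D) ≤ 1 / 2 := by
      rw [div_le_div_iff₀ hw0 (by norm_num)]
      have : 0 ≤ Q * w := by positivity
      nlinarith
    have h3' : 0 < S / (Q * w + D) := by positivity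
    have h4 : 1 / 2 ≤ Q * |S * x - p| := by
      have e' : Q * |S * x - p| = |Q * (S * x - p)| := by rw [abs_mul, abs_of_pos hQ]
      rw [e', e]
      have := abs_sub_abs_le_abs_sub ((P : ℝ) * S - p * Q) (S / (Q * w + D))
      rw [abs_of_pos h3'] at this
      linarith
    have h5 : (Q : ℝ) ≤ 4 * R ^ 2 * S := by
      have h6 : (Q : ℝ) ^ 2 * 1 ≤ Q ^ 2 * (2 * R * ℓ * (S : ℝ) ^ 2) := by gcongr
      have h7 : (Q : ℝ) ^ 2 * (2 * R * ℓ * (S : ℝ) ^ 2) ≤ 8 * R ^ 3 * (2 * R * S ^ 2) := by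
        calc (Q : ℝ) ^ 2 * (2 * R * ℓ * (S : ℝ) ^ 2) = Q ^ 2 * ℓ * (2 * R * S ^ 2) := by ring
          _ ≤ _ := mul_le_mul_of_nonneg_right hg.len_le (by positivity)
      refine le_of_sq_le_sq ?_ (by positivity)
      calc (Q : ℝ) ^ 2 = Q ^ 2 * 1 := (mul_one _).symm
        _ ≤ _ := h6.trans h7
        _ = _ := by ring
    calc (1 : ℝ) ≤ 2 * (Q * |S * x - p|) := by linarith
      _ ≤ 2 * (4 * R ^ 2 * S * |S * x - p|) := by gcongr
      _ = _ := by ring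
  push Not at hSQ
  have hSQ' : (Q : ℝ) ≤ S := by exact_mod_cast hSQ
  set α := D * p - B * S with hα
  set β := P * S - Q * p with hβ
  have eS : Q * α + D * β = S := by
    rw [hα, hβ]; linear_combination S * hg.det
  have eS' : (Q : ℝ) * α + D * β = S := by exact_mod_cast eS
  have e : S * x - p = (β * w - α) / (Q * w + D) := by
    rw [eq_div_iff hw0.ne', hx, sub_mul, mul_assoc, div_mul_cancel₀ _ hw0.ne', hα, hβ]
    push_cast
    ring
  rw [e, abs_div, abs_of_pos hw0]
  have e2 : 8 * (R : ℝ) ^ 2 * (S * (|β * w - α| / (Q * w + D))) =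
      8 * R ^ 2 * (|β * w - α| * S) / (Q * w + D) := by ring
  rw [e2, le_div_iff₀ hw0, one_mul]
  have hden : Q * w + D ≤ 2 * D := by linarith
  have h8 : 16 * (1 / 2 : ℝ) ≤ 8 * R ^ 2 := by nlinarith
  by_cases hβ0 : 0 < β
  · have hβ1 : (1 : ℝ) ≤ β := by exact_mod_cast hβ0
    have hbw : (β : ℝ) * (1 / 4) ≤ β * w := by gcongr
    have hbw' : (β : ℝ) * w ≤ β * (3 / 4) := by gcongr
    by_cases hα0 : 0 ≤ α
    · by_cases hαβ : α ≤ β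
      · have := h α β hα0 hαβ hβ0 (by rw [eS]; exact hST)
        rwa [eS] at this
      · push Not at hαβ
        have hαβ' : (β : ℝ) + 1 ≤ α := by exact_mod_cast hαβ
        have h2 : 1 ≤ |β * w - α| := by
          rw [abs_of_nonpos (by linarith)]; linarith
        have h3 : (D : ℝ) ≤ S := by
          have : (D : ℝ) * 1 ≤ D * β := by gcongr
          have : 0 ≤ (Q : ℝ) * α := mul_nonneg hQ.le (by linarith)
          linarith
        calc Q * w + D ≤ 8 * (1 * D) := by linarith
          _ ≤ 8 * R ^ 2 * (|β * w - α| * S) := by gcongr; nlinarith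
    · push Not at hα0
      have hα1 : (α : ℝ) ≤ -1 := by
        have : α ≤ -1 := by omega
        exact_mod_cast this
      have h2 : -(α : ℝ) ≤ |β * w - α| := by
        rw [abs_of_nonneg (by linarith)]; linarith
      have h3 : (D : ℝ) / 2 ≤ |β * w - α| * S := by
        have hDβ : (D : ℝ) * 1 ≤ D * β := by gcongr
        by_cases hc : (D : ℝ) / 2 ≤ S
        · calc (D : ℝ) / 2 ≤ 1 * S := by linarith
            _ ≤ _ := by gcongr; linarith
        · push Not at hc
          calc (D : ℝ) / 2 ≤ -α * Q := by linarith
            _ ≤ |β * w - α| * S := by gcongr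
      calc Q * w + D ≤ 8 * (D / 2) := by linarith
        _ ≤ 8 * R ^ 2 * (|β * w - α| * S) := by gcongr; nlinarith
  · push Not at hβ0
    have hβ1 : (β : ℝ) ≤ 0 := by exact_mod_cast hβ0
    have hDβ : (D : ℝ) * β ≤ 0 := mul_nonpos_of_nonneg_of_nonpos hD0.le hβ1
    have hαS : (S : ℝ) ≤ Q * α := by linarith
    have hα1 : (1 : ℝ) ≤ α := by
      have : (Q : ℝ) * 1 ≤ Q * α := by linarith
      exact le_of_mul_le_mul_left this hQ
    have hbw : (β : ℝ) * w ≤ 0 := mul_nonpos_of_nonpos_of_nonneg hβ1 (by linarith)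
    have h2 : (α : ℝ) ≤ |β * w - α| := by
      rw [abs_of_nonpos (by linarith)]; linarith
    calc Q * w + D ≤ (24 * R + 2) * Q := by linarith
      _ ≤ 8 * R ^ 2 * Q := by gcongr; nlinarith
      _ ≤ 8 * R ^ 2 * (1 * S) := by rw [one_mul]; gcongr
      _ ≤ _ := by gcongr; linarith

end IsPrefix

/-- The Möbius transformation of the matrix with rows `u` and `v`. -/
noncomputable def mobius (u v : ℤ × ℤ) (y : ℝ) : ℝ := (u.1 * y + u.2) / (v.1 * y + v.2)

theorem hasDerivAt_mobius {u v : ℤ × ℤ} (hdet : u.1 * v.2 - u.2 * v.1 = 1) {y : ℝ}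
    (hy : 0 < v.1 * y + v.2) : HasDerivAt (mobius u v) (1 / (v.1 * y + v.2) ^ 2) y := by
  have hdet' : (u.1 : ℝ) * v.2 - u.2 * v.1 = 1 := by exact_mod_cast hdet
  have h1 : HasDerivAt (fun y : ℝ => u.1 * y + u.2) (u.1 : ℝ) y := by
    simpa using ((hasDerivAt_id y).const_mul (u.1 : ℝ)).add_const (u.2 : ℝ)
  have h2 : HasDerivAt (fun y : ℝ => v.1 * y + v.2) (v.1 : ℝ) y := by
    simpa using ((hasDerivAt_id y).const_mul (v.1 : ℝ)).add_const (v.2 : ℝ)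
  refine (h1.div h2 hy.ne').congr_deriv ?_
  congr 1
  linear_combination hdet'

theorem mobius_sub_mobius {u v : ℤ × ℤ} (hdet : u.1 * v.2 - u.2 * v.1 = 1) {x y : ℝ}
    (hx : 0 < v.1 * x + v.2) (hy : 0 < v.1 * y + v.2) :
    mobius u v y - mobius u v x = (y - x) / ((v.1 * x + v.2) * (v.1 * y + v.2)) := by
  have hdet' : (u.1 : ℝ) * v.2 - u.2 * v.1 = 1 := by exact_mod_cast hdet
  rw [mobius, mobius, div_sub_div _ _ hy.ne' hx.ne', div_eq_div_iff (by positivity) (by positivity)]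
  linear_combination ((v.1 * x + v.2) * (v.1 * y + v.2) * (y - x) : ℝ) * hdet'

theorem mobius_wordMap (u v : ℤ × ℤ) (l : List Bool) {y : ℝ} (hy : y ∈ Icc (1 / 4) (3 / 4 : ℝ)) :
    mobius u v (wordMap l y) = mobius (wordRow u l) (wordRow v l) y := by
  obtain ⟨q, hq, h⟩ := wordMap_linear l hy
  rw [mobius, h u, h v, mobius, div_div_div_cancel_right₀ hq.ne']

theorem one_sub_pow_two_pow_le {m : ℕ} (hm : 1 ≤ m) :
    (1 - 4 * (((2 : ℝ) ^ m)⁻¹) ^ 2) ^ (2 ^ (3 * m) : ℕ) ≤ 1 / (4 * ((2 ^ (3 * m) : ℕ) : ℝ)) := by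
  set x : ℝ := 2 ^ m with hx
  have hx2 : 2 ≤ x := le_self_pow₀ (by norm_num) (by omega)
  have hx0 : 0 < x := by linarith
  have e : ((2 ^ (3 * m) : ℕ) : ℝ) = x ^ 3 := by
    push_cast
    rw [hx, ← pow_mul, mul_comm]
  have hbase : 0 ≤ 1 - 4 * x⁻¹ ^ 2 := by
    have : x⁻¹ ≤ 2⁻¹ := by gcongr
    nlinarith [inv_pos.mpr hx0]
  have h1 : 1 - 4 * x⁻¹ ^ 2 ≤ Real.exp (-(4 * x⁻¹ ^ 2)) := by
    linarith [Real.add_one_le_exp (-(4 * x⁻¹ ^ 2))]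
  have h2 : 4 * x ^ 3 ≤ Real.exp (4 * x) := by
    have := Real.pow_div_factorial_le_exp (4 * x) (by positivity) 3
    norm_num [Nat.factorial] at this
    nlinarith [pow_pos hx0 3]
  calc (1 - 4 * x⁻¹ ^ 2) ^ (2 ^ (3 * m) : ℕ)
      ≤ Real.exp (-(4 * x⁻¹ ^ 2)) ^ (2 ^ (3 * m) : ℕ) := pow_le_pow_left₀ hbase h1 _
    _ = (Real.exp (4 * x))⁻¹ := by
      rw [← Real.exp_nat_mul, e, ← Real.exp_neg]
      congr 1
      field_simp
    _ ≤ (4 * x ^ 3)⁻¹ := by gcongr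
    _ = _ := by rw [e, one_div]

theorem volume_forall_word_le {u v : ℤ × ℤ} (hdet : u.1 * v.2 - u.2 * v.1 = 1) (h1 : 0 ≤ v.1)
    (h2 : v.1 ≤ v.2) (h3 : 0 < v.2) {m : ℕ} (hm : 6 ≤ m) {N : ℝ}
    (hN : ((2 : ℝ) ^ m) ^ 400 * v.2 ^ 2 ≤ N) (δ : ℝ) :
    volume.real {y ∈ Icc (1 / 4) (3 / 4 : ℝ) | ∀ i : Fin (9 * m) → Bool, ((2 : ℝ) ^ m)⁻¹ ≤
      nint (N * mobius (wordRow u (List.ofFn i)) (wordRow v (List.ofFn i)) y - δ)} ≤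
        32 / ((2 : ℝ) ^ m) ^ 3 := by
  set x : ℝ := 2 ^ m with hx
  have hx64 : 64 ≤ x := by
    calc (64 : ℝ) = 2 ^ 6 := by norm_num
      _ ≤ x := pow_le_pow_right₀ (by norm_num) hm
  have hx0 : 0 < x := by linarith
  have hx1 : 1 ≤ x := by linarith
  have hD : (0 : ℝ) < v.2 := by exact_mod_cast h3
  have h7 : (7 : ℝ) ^ (9 * m) ≤ x ^ 27 := by
    rw [hx, ← pow_mul, mul_comm m, pow_mul, pow_mul]
    gcongr
    norm_num
  have hN0 : 0 < N := lt_of_lt_of_le (by positivity) hN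
  set φ : (Fin (9 * m) → Bool) → ℝ → ℝ := fun i y =>
    N * mobius (wordRow u (List.ofFn i)) (wordRow v (List.ofFn i)) y with hφ
  have hbd : ∀ i : Fin (9 * m) → Bool, (0 : ℝ) ≤ (wordRow v (List.ofFn i)).1 ∧
      ((wordRow v (List.ofFn i)).1 : ℝ) ≤ (wordRow v (List.ofFn i)).2 ∧
      (v.2 : ℝ) ≤ (wordRow v (List.ofFn i)).2 ∧
      ((wordRow v (List.ofFn i)).2 : ℝ) ≤ x ^ 27 * v.2 := by
    intro i
    obtain ⟨b1, b2, b3, b4⟩ := wordRow_bounds (List.ofFn i) h1 h2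
    rw [List.length_ofFn] at b4
    refine ⟨by exact_mod_cast b1, by exact_mod_cast b2, by exact_mod_cast b3, ?_⟩
    calc ((wordRow v (List.ofFn i)).2 : ℝ) ≤ 7 ^ (9 * m) * v.2 := by exact_mod_cast b4
      _ ≤ _ := by gcongr
  have hpos : ∀ i : Fin (9 * m) → Bool, ∀ y ∈ Icc (1 / 4) (3 / 4 : ℝ),
      0 < ((wordRow v (List.ofFn i)).1 : ℝ) * y + (wordRow v (List.ofFn i)).2 := by
    intro i y hy
    obtain ⟨b1, b2, b3, b4⟩ := hbd i
    have : 0 ≤ ((wordRow v (List.ofFn i)).1 : ℝ) * y := mul_nonneg b1 (by linarith [hy.1])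
    linarith
  have hder : ∀ i : Fin (9 * m) → Bool, ∀ y ∈ Icc (1 / 4) (3 / 4 : ℝ), HasDerivAt (φ i)
      (N * (1 / ((wordRow v (List.ofFn i)).1 * y + (wordRow v (List.ofFn i)).2) ^ 2)) y := by
    intro i y hy
    refine (hasDerivAt_mobius ?_ (hpos i y hy)).const_mul N
    rw [wordRow_det, hdet]
  have hmain := volume_forall_le_nint_le (φ := φ) (κ := 1 / x ^ 9) (ρ := x⁻¹) (δ := δ)
    (K := 2 ^ (3 * m)) Nat.one_le_two_pow
    (fun i y hy => (hder i y hy).continuousAt.continuousWithinAt) ?_ (by positivity)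
    (by positivity) (one_sub_pow_two_pow_le (by omega))
  · refine hmain.trans_eq ?_
    rw [Fintype.card_fun, Fintype.card_fin, Fintype.card_bool]
    push_cast
    have e1 : (2 : ℝ) ^ (9 * m) = x ^ 9 := by rw [hx, ← pow_mul, mul_comm]
    have e2 : (2 : ℝ) ^ (3 * m) = x ^ 3 := by rw [hx, ← pow_mul, mul_comm]
    rw [e1, e2]
    field_simp
    norm_num
  · intro k hk i j hij
    obtain ⟨b1, b2, b3, b4⟩ := hbd i
    obtain ⟨c1, c2, c3, c4⟩ := hbd j
    have hk1 : (1 : ℝ) ≤ |(k : ℝ)| := by exact_mod_cast Int.one_le_abs hk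
    have hk0 : (k : ℝ) ≠ 0 := by exact_mod_cast hk
    have hΩ : N ≤ |2 * π * k * N| := by
      rw [abs_mul, abs_of_pos hN0, abs_mul, abs_of_pos (by positivity : 0 < 2 * π)]
      have : 1 ≤ 2 * π * |(k : ℝ)| := by nlinarith [Real.pi_gt_three]
      nlinarith
    have hsep := wordRow_separated h1 h2 (List.ofFn i) (List.ofFn j) (by simp)
      (fun h => hij (List.ofFn_injective h))
    rw [List.length_ofFn] at hsep
    have hsep' : 1 / (9 * x ^ 27) * v.2 ≤
        max |((wordRow v (List.ofFn j)).1 : ℝ) - (wordRow v (List.ofFn i)).1|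
          |((wordRow v (List.ofFn j)).2 : ℝ) - (wordRow v (List.ofFn i)).2| := by
      set Mx := max |((wordRow v (List.ofFn j)).1 : ℝ) - (wordRow v (List.ofFn i)).1|
          |((wordRow v (List.ofFn j)).2 : ℝ) - (wordRow v (List.ofFn i)).2| with hMx
      have hMx0 : 0 ≤ Mx := le_max_of_le_left (abs_nonneg _)
      have : (v.2 : ℝ) ≤ 9 * 7 ^ (9 * m) * Mx := by
        rw [hMx]
        exact_mod_cast hsep
      rw [one_div_mul_eq_div, div_le_iff₀ (by positivity)]
      calc (v.2 : ℝ) ≤ 9 * 7 ^ (9 * m) * Mx := this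
        _ ≤ 9 * x ^ 27 * Mx := by gcongr
        _ = _ := mul_comm _ _
    have hx10 : 64 ≤ x ^ 10 := hx64.trans (le_self_pow₀ hx1 (by norm_num))
    have := norm_integral_exp_mobius_sub_le (K := x ^ 27) (η := 1 / (9 * x ^ 27))
      (τ := 1 / x ^ 37) (Ω := 2 * π * k * N) (ψ := fun y => 2 * π * k * (φ i y - φ j y)) hD
      (one_le_pow₀ hx1) b1 b2 c1 c2 b3 b4 c3 c4 (by positivity) (by positivity)
      (by rw [div_le_one (by positivity)]; exact one_le_pow₀ hx1)
      (by
        rw [mul_one_div, div_le_div_iff₀ (by positivity) (by positivity)]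
        calc 2 * (9 * x ^ 27) = 18 * x ^ 27 := by ring
          _ ≤ x ^ 10 * x ^ 27 := by gcongr; linarith
          _ = _ := by ring)
      (by positivity)
      (fun y hy => by
        refine (((hder i y hy).sub (hder j y hy)).const_mul (2 * π * k)).congr_deriv ?_
        ring)
      hsep'
    refine this.trans ?_
    have h5 : x ^ 400 ≤ |2 * π * k * N| / (v.2 : ℝ) ^ 2 := by
      rw [le_div_iff₀ (by positivity)]
      exact hN.trans hΩ
    calc 4 * (1 / x ^ 37) / (1 / (9 * x ^ 27)) +
          288 * (x ^ 27) ^ 8 / (|2 * π * k * N| / (v.2 : ℝ) ^ 2 * (1 / x ^ 37) ^ 2)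
        ≤ 4 * (1 / x ^ 37) / (1 / (9 * x ^ 27)) +
          288 * (x ^ 27) ^ 8 / (x ^ 400 * (1 / x ^ 37) ^ 2) := by gcongr
      _ = (36 + 288 / x ^ 100) / x ^ 10 := by field_simp; ring
      _ ≤ 64 / x ^ 10 := by
        gcongr
        have : 288 / x ^ 100 ≤ 288 / x ^ 2 := by gcongr; norm_num
        have : 288 / x ^ 2 ≤ 288 / 64 ^ 2 := by gcongr
        norm_num at this
        linarith
      _ ≤ x / x ^ 10 := by gcongr
      _ = 1 / x ^ 9 := by field_simp

theorem nint_le_nint_add (x y : ℝ) : nint x ≤ nint y + |x - y| := by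
  rw [← sub_le_iff_le_add]
  refine le_ciInf fun k => ?_
  linarith [nint_le_abs_sub x k, abs_sub_le x y k]

theorem lt_one_sub_pow {m : ℕ} (hm : 4 ≤ m) :
    32 / ((2 : ℝ) ^ m) ^ 3 < 1 / 2 * (1 - 2 / ((1024 : ℕ) : ℝ)) ^ (41 * m) := by
  have h1 : (1 / 2 : ℝ) ^ m ≤ (1 - 2 / ((1024 : ℕ) : ℝ)) ^ (41 * m) := by
    rw [pow_mul]
    gcongr
    norm_num
  have h2 : (16 : ℝ) ≤ 2 ^ m := by
    calc (16 : ℝ) = 2 ^ 4 := by norm_num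
      _ ≤ _ := pow_le_pow_right₀ (by norm_num) hm
  refine lt_of_lt_of_le ?_ (mul_le_mul_of_nonneg_left h1 (by norm_num))
  rw [one_div_pow]
  set x : ℝ := 2 ^ m
  rw [div_mul_div_comm, div_lt_div_iff₀ (by positivity) (by positivity)]
  have : (0 : ℝ) < x := by linarith
  nlinarith [mul_pos this this]

/-- Inside a good interval of length `ℓ`, and for `N ℓ` in a suitable range, there is a good
subinterval on which `N x` is close to `δ` modulo one. -/
theorem GoodInterval.exists_hit {R : ℕ} (hR : 2 ^ 13 ≤ R) {m : ℕ} (hm : 6 ≤ m)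
    (hmR : 5000 * (R : ℝ) ^ 5 ≤ 2 ^ m) {a ℓ : ℝ} (hℓ : 0 < ℓ) (hℓ1 : ℓ ≤ 1)
    (h : GoodInterval R a ℓ) {N : ℝ} (hN : ((2 : ℝ) ^ m) ^ 401 ≤ N * ℓ)
    (hN' : N * ℓ ≤ ((2 : ℝ) ^ m) ^ 404) (δ : ℝ) :
    ∃ a' ℓ' : ℝ, a ≤ a' ∧ a' + ℓ' ≤ a + ℓ ∧ 0 < ℓ' ∧ ℓ ≤ ((2 : ℝ) ^ m) ^ 500 * ℓ' ∧
      GoodInterval R a' ℓ' ∧ ∀ x ∈ Icc a' (a' + ℓ'), nint (N * x - δ) < 2 / 2 ^ m := by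
  obtain ⟨P, Q, B, D, hg⟩ := h.exists_isPrefix (by omega) hℓ hℓ1
  set X : ℝ := 2 ^ m with hX
  have hX64 : 64 ≤ X := by
    calc (64 : ℝ) = 2 ^ 6 := by norm_num
      _ ≤ X := pow_le_pow_right₀ (by norm_num) hm
  have hX0 : 0 < X := by linarith
  have hX1 : 1 ≤ X := by linarith
  have hR' : (2 : ℝ) ^ 13 ≤ R := by exact_mod_cast hR
  have hR8 : (8192 : ℝ) ≤ R := by linarith
  have hQ : (0 : ℝ) < Q := by exact_mod_cast hg.pos
  have hQD := hg.Q_le_D (by omega)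
  have hD : (0 : ℝ) < D := by exact_mod_cast hg.pos.trans_le hQD
  have hD1 : 24 * R * (Q : ℝ) ≤ D := by exact_mod_cast hg.le_D
  have hD2 : (D : ℝ) ≤ (24 * R + 1) * Q := by exact_mod_cast hg.D_le
  have hDℓ : (D : ℝ) ^ 2 * ℓ ≤ X := by
    have : (D : ℝ) ≤ 25 * R * Q := hD2.trans (by gcongr; linarith)
    calc (D : ℝ) ^ 2 * ℓ ≤ (25 * R * Q) ^ 2 * ℓ := by gcongr
      _ = 625 * R ^ 2 * (Q ^ 2 * ℓ) := by ring
      _ ≤ 625 * R ^ 2 * (8 * R ^ 3) := by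
        exact mul_le_mul_of_nonneg_left hg.len_le (by positivity)
      _ = 5000 * (R : ℝ) ^ 5 := by ring
      _ ≤ X := hmR
  have hDℓ' : 1 ≤ (D : ℝ) ^ 2 * ℓ := by
    calc (1 : ℝ) ≤ 8 * R * ℓ * (Q : ℝ) ^ 2 := hg.lt_len.le
      _ ≤ (24 * R) ^ 2 * ℓ * Q ^ 2 := by gcongr; nlinarith
      _ = (24 * R * Q) ^ 2 * ℓ := by ring
      _ ≤ _ := by gcongr
  have hND : X ^ 400 * (D : ℝ) ^ 2 ≤ N := by
    refine le_of_mul_le_mul_right ?_ hℓ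
    calc X ^ 400 * (D : ℝ) ^ 2 * ℓ = X ^ 400 * (D ^ 2 * ℓ) := by ring
      _ ≤ X ^ 400 * X := by gcongr
      _ = X ^ 401 := by ring
      _ ≤ _ := hN
  have hN0 : 0 < N := lt_of_lt_of_le (by positivity) hND
  have hND' : N ≤ X ^ 404 * (D : ℝ) ^ 2 := by
    refine le_of_mul_le_mul_right ?_ hℓ
    calc N * ℓ ≤ X ^ 404 * 1 := by rwa [mul_one]
      _ ≤ X ^ 404 * (D ^ 2 * ℓ) := by gcongr
      _ = _ := by ring
  set u : ℤ × ℤ := (P, B) with hu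
  set v : ℤ × ℤ := (Q, D) with hv
  have hdet : u.1 * v.2 - u.2 * v.1 = 1 := hg.det
  have hvol := volume_forall_word_le hdet hg.pos.le hQD (hg.pos.trans_le hQD) hm hND δ
  set E := {y ∈ Icc (1 / 4) (3 / 4 : ℝ) | ∀ i : Fin (9 * m) → Bool, ((2 : ℝ) ^ m)⁻¹ ≤
      nint (N * mobius (wordRow u (List.ofFn i)) (wordRow v (List.ofFn i)) y - δ)} with hE
  have hE1 : volume.real (E ∩ Ico (1 / 4) (1 / 4 + 1 / 2)) <
      1 / 2 * (1 - 2 / ((1024 : ℕ) : ℝ)) ^ (41 * m) := by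
    refine lt_of_le_of_lt ((measureReal_mono inter_subset_left ?_).trans hvol)
      (lt_one_sub_pow (by omega))
    exact ((measure_mono (sep_subset _ _)).trans_lt measure_Icc_lt_top).ne
  have hgood : GoodInterval (1024 : ℕ) (1 / 4) (1 / 2) := by
    intro p q hq hs
    exfalso
    have : (1 : ℝ) ≤ q := by exact_mod_cast hq
    norm_num at hs
    nlinarith
  obtain ⟨y₀, hy1, hy2, hyg, hyE⟩ := GoodInterval.exists_part_not_covered (by norm_num) E (41 * m)
    (by norm_num) hgood hE1
  set s : ℝ := 1 / 2 / ((1024 : ℕ) : ℝ) ^ (41 * m) with hs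
  have hs' : s = 1 / (2 * X ^ 410) := by
    rw [hs, hX, div_div, ← pow_mul]
    congr 2
    push_cast
    rw [show (1024 : ℝ) = 2 ^ 10 by norm_num, ← pow_mul]
    congr 1
    ring
  have hs0 : 0 < s := by rw [hs']; positivity
  obtain ⟨y, hyI, hyn⟩ : ∃ y ∈ Ico y₀ (y₀ + s), y ∉ E := by
    by_contra hcon
    push Not at hcon
    rw [inter_eq_self_of_subset_right hcon, Real.volume_real_Ico_of_le (by linarith)] at hyE
    linarith
  have hsub : ∀ {z}, z ∈ Icc y₀ (y₀ + s) → z ∈ Icc (1 / 4) (3 / 4 : ℝ) := fun hz =>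
    ⟨by linarith [hz.1], by linarith [hz.2]⟩
  obtain ⟨i, hi⟩ : ∃ i : Fin (9 * m) → Bool,
      nint (N * mobius (wordRow u (List.ofFn i)) (wordRow v (List.ofFn i)) y - δ) < X⁻¹ := by
    by_contra hcon
    push Not at hcon
    exact hyn ⟨hsub (Ico_subset_Icc_self hyI), hcon⟩
  set l := List.ofFn i with hl
  obtain ⟨b1, b2, b3, b4⟩ := wordRow_bounds (v := v) l hg.pos.le hQD
  rw [hl, List.length_ofFn, ← hl] at b4
  have hdet' : (wordRow u l).1 * (wordRow v l).2 - (wordRow u l).2 * (wordRow v l).1 = 1 := by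
    rw [wordRow_det, hdet]
  set C : ℝ := ((wordRow v l).1 : ℝ) with hC
  set F : ℝ := ((wordRow v l).2 : ℝ) with hF
  have hC0 : 0 ≤ C := by rw [hC]; exact_mod_cast b1
  have hCF : C ≤ F := by rw [hC, hF]; exact_mod_cast b2
  have hDF : (D : ℝ) ≤ F := by rw [hF]; exact_mod_cast b3
  have hFD : F ≤ X ^ 27 * D := by
    have h7 : (7 : ℝ) ^ (9 * m) ≤ X ^ 27 := by
      rw [hX, ← pow_mul, mul_comm m, pow_mul, pow_mul]
      gcongr
      norm_num
    calc F ≤ 7 ^ (9 * m) * D := by rw [hF]; exact_mod_cast b4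
      _ ≤ _ := by gcongr
  have hF0 : 0 < F := by linarith
  have hden : ∀ {z}, z ∈ Icc y₀ (y₀ + s) → F ≤ C * z + F ∧ C * z + F ≤ 2 * F := by
    intro z hz
    have hz' := hsub hz
    have h5 : 0 ≤ C * z := mul_nonneg hC0 (by linarith [hz'.1])
    have h6 : C * z ≤ C * 1 := by gcongr; linarith [hz'.2]
    constructor <;> linarith
  set γ := mobius (wordRow u l) (wordRow v l) with hγ
  have hγsub : ∀ {z w}, z ∈ Icc y₀ (y₀ + s) → w ∈ Icc y₀ (y₀ + s) →
      γ w - γ z = (w - z) / ((C * z + F) * (C * w + F)) := fun hz hw =>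
    mobius_sub_mobius hdet' (by linarith [(hden hz).1]) (by linarith [(hden hw).1])
  have hL : y₀ ∈ Icc y₀ (y₀ + s) := ⟨le_rfl, by linarith⟩
  have hU : y₀ + s ∈ Icc y₀ (y₀ + s) := ⟨by linarith, le_rfl⟩
  set ℓ' := γ (y₀ + s) - γ y₀ with hℓ'
  have eℓ' : ℓ' = s / ((C * y₀ + F) * (C * (y₀ + s) + F)) := by
    rw [hℓ', hγsub hL hU, add_sub_cancel_left]
  have hsℓ' : s ≤ 4 * F ^ 2 * ℓ' := by
    have h5 := hden hL
    have h6 := hden hU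
    have h7 : 0 < C * y₀ + F := by linarith
    have h8 : 0 < C * (y₀ + s) + F := by linarith
    rw [eℓ', mul_div_assoc', le_div_iff₀ (by positivity)]
    calc s * ((C * y₀ + F) * (C * (y₀ + s) + F)) ≤ s * ((2 * F) * (2 * F)) := by
          gcongr <;> linarith
      _ = _ := by ring
  have hℓ'0 : 0 < ℓ' := by
    by_contra hcon
    push Not at hcon
    have : 4 * F ^ 2 * ℓ' ≤ 0 := mul_nonpos_of_nonneg_of_nonpos (by positivity) hcon
    linarith
  have hcont : ContinuousOn γ (Icc y₀ (y₀ + s)) := fun z hz =>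
    (hasDerivAt_mobius hdet' (by linarith [(hden hz).1])).continuousAt.continuousWithinAt
  have hmem : ∀ {z}, z ∈ Icc y₀ (y₀ + s) →
      γ z = (P * wordMap l z + B) / (Q * wordMap l z + D) := fun hz =>
    (mobius_wordMap u v l (hsub hz)).symm
  have hmem' : ∀ {z}, z ∈ Icc y₀ (y₀ + s) → γ z ∈ Icc a (a + ℓ) := by
    intro z hz
    rw [hmem hz]
    exact hg.map_mem (by omega) (by linarith [(wordMap_mem (l := l) (hsub hz)).1])
  have hsurj : ∀ {x}, x ∈ Icc (γ y₀) (γ y₀ + ℓ') → ∃ z ∈ Icc y₀ (y₀ + s), γ z = x := by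
    intro x hx
    rw [hℓ', add_sub_cancel] at hx
    exact intermediate_value_Icc (by linarith) hcont hx
  refine ⟨γ y₀, ℓ', (hmem' hL).1, ?_, hℓ'0, ?_, ?_, ?_⟩
  · rw [hℓ', add_sub_cancel]
    exact (hmem' hU).2
  · have h5 : X ^ 410 * (2 * s) = 1 := by rw [hs']; field_simp
    calc ℓ = ℓ * (X ^ 410 * (2 * s)) := by rw [h5, mul_one]
      _ ≤ ℓ * (X ^ 410 * (2 * (4 * (X ^ 27 * D) ^ 2 * ℓ'))) := by
        gcongr
        exact hsℓ'.trans (by gcongr)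
      _ = 8 * X ^ 464 * ℓ' * (D ^ 2 * ℓ) := by ring
      _ ≤ X * X ^ 464 * ℓ' * X := by gcongr; linarith
      _ = X ^ 466 * ℓ' := by ring
      _ ≤ X ^ 500 * ℓ' := by gcongr; norm_num
  · intro p q hq hqℓ x hx
    obtain ⟨z, hz, rfl⟩ := hsurj hx
    rw [hmem hz]
    have hq0 : (0 : ℝ) < q := by exact_mod_cast hq
    refine hg.badly_approximable (by omega) h (wordMap_mem (hsub hz)) (T := q) ?_ hq le_rfl
    intro α β hα hαβ hβ hT
    have key := wordMap_badly_approximable (M := 2 ^ 23) (T := q) (by norm_num) (hsub hz) l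
      (v := v) hg.pos.le hQD (hg.pos.trans_le hQD) (fun c b hb hbT => ?_) hα hαβ hβ hT
    · refine key.trans ?_
      have : 2 * (2 : ℝ) ^ 23 ≤ 8 * R ^ 2 := by
        calc 2 * (2 : ℝ) ^ 23 ≤ 8 * (2 ^ 13) ^ 2 := by norm_num
          _ ≤ _ := by gcongr
      refine mul_le_mul_of_nonneg_right this (mul_nonneg (abs_nonneg _) ?_)
      have : (0 : ℤ) ≤ Q * α + D * β := add_nonneg (mul_nonneg hg.pos.le hα)
        (mul_nonneg (hg.pos.le.trans hQD) hβ.le)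
      exact_mod_cast this
    · have hb0 : (0 : ℝ) < b := by exact_mod_cast hb
      have := hyg c b hb ?_ z hz
      · norm_num at this ⊢
        exact this
      · push_cast
        calc 2 * 1024 * s * (b : ℝ) ^ 2 ≤ 2 * 1024 * (4 * F ^ 2 * ℓ') * b ^ 2 := by gcongr
          _ = 8192 * ℓ' * (b * F) ^ 2 := by ring
          _ ≤ 8192 * ℓ' * q ^ 2 := by gcongr
          _ ≤ (2 * R) * ℓ' * q ^ 2 := by gcongr; linarith
          _ ≤ 1 := hqℓ
  · intro x hx
    obtain ⟨z, hz, rfl⟩ := hsurj hx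
    have hyI' := Ico_subset_Icc_self hyI
    have h5 : |γ z - γ y| ≤ s / D ^ 2 := by
      rw [hγsub hyI' hz, abs_div, sq, abs_of_pos (a := (C * y + F) * (C * z + F))
        (mul_pos (by linarith [(hden hyI').1]) (by linarith [(hden hz).1]))]
      have h6 := (hden hyI').1
      have h7 := (hden hz).1
      have h8 : |z - y| ≤ s := by
        rw [abs_le]
        constructor <;> linarith [hz.1, hz.2, hyI'.1, hyI'.2]
      gcongr <;> linarith
    have h6 : N * |γ z - γ y| ≤ X⁻¹ := by
      calc N * |γ z - γ y| ≤ X ^ 404 * (D : ℝ) ^ 2 * (s / D ^ 2) := by gcongr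
        _ = X ^ 404 * s := by field_simp
        _ = 1 / (2 * X ^ 6) := by rw [hs']; field_simp
        _ ≤ 1 / (1 * X ^ 1) := by gcongr <;> norm_num
        _ = X⁻¹ := by simp
    have h7 := nint_le_nint_add (N * γ z - δ) (N * γ y - δ)
    have e : N * γ z - δ - (N * γ y - δ) = N * (γ z - γ y) := by ring
    rw [e, abs_mul, abs_of_pos hN0] at h7
    have h8 : 2 / X = X⁻¹ + X⁻¹ := by ring
    linarith

/-- The vertex reached from the root of a `b`-ary tree of sets by following the digits `ω`. -/
def treePath {b : ℕ} {T : ℕ → Set ℝ → Prop} (root : {I // T 0 I})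
    (child : ∀ j, {I // T j I} → Fin b → {I // T (j + 1) I}) (ω : ℕ → Fin b) :
    ∀ j, {I // T j I}
  | 0 => root
  | j + 1 => child j (treePath root child ω j) (ω j)

theorem treePath_congr {b : ℕ} {T : ℕ → Set ℝ → Prop} (root : {I // T 0 I})
    (child : ∀ j, {I // T j I} → Fin b → {I // T (j + 1) I}) {ω ω' : ℕ → Fin b} {j : ℕ}
    (h : ∀ i < j, ω i = ω' i) : treePath root child ω j = treePath root child ω' j := by
  induction j with
  | zero => rfl
  | succ j ih =>
    simp only [treePath]
    rw [ih fun i hi => h i (by omega), h j (by omega)]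

/-- A lower bound for the Hausdorff dimension of a set which contains all the points which lie in
a vertex of each level of a `b`-ary tree of compact sets with separated children. -/
theorem le_dimH_of_tree {b : ℕ} (hb : 1 < b) {C σ : NNReal} (hσ : 0 < σ) {T : ℕ → Set ℝ → Prop}
    (hroot : ∃ I, T 0 I) (hT : ∀ j I, T j I → IsCompact I ∧ I.Nonempty)
    (hstep : ∀ j I, T j I → ∃ J : Fin b → Set ℝ, (∀ d, T (j + 1) (J d) ∧ J d ⊆ I) ∧
      ∀ d d', d ≠ d' → ∀ x ∈ J d, ∀ y ∈ J d', ((b : ℝ) ^ j)⁻¹ ≤ C * |x - y| ^ (σ : ℝ))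
    {G : Set ℝ} (hG : ∀ x, (∀ j, ∃ I, T j I ∧ x ∈ I) → x ∈ G) : (σ : ENNReal) ≤ dimH G := by
  obtain ⟨I₀, hI₀⟩ := hroot
  choose! J hJ hsep using hstep
  set child : ∀ j, {I // T j I} → Fin b → {I // T (j + 1) I} := fun j I d =>
    ⟨J j I.1 d, (hJ j I.1 I.2 d).1⟩ with hchild
  set path := treePath ⟨I₀, hI₀⟩ child with hpath
  have hne : ∀ ω, (⋂ j, (path ω j).1).Nonempty := fun ω =>
    IsCompact.nonempty_iInter_of_sequence_nonempty_isCompact_isClosed _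
      (fun j => (hJ j (path ω j).1 (path ω j).2 (ω j)).2) (fun j => (hT j _ (path ω j).2).2)
      (hT 0 _ (path ω 0).2).1 (fun j => (hT j _ (path ω j).2).1.isClosed)
  choose x hx using hne
  have hx' : ∀ ω j, x ω ∈ (path ω j).1 := fun ω j => mem_iInter.mp (hx ω) j
  have hdist : ∀ ω ω', ω ≠ ω' → ∃ j, (∀ i < j, ω i = ω' i) ∧
      ((b : ℝ) ^ j)⁻¹ ≤ C * |x ω - x ω'| ^ (σ : ℝ) := by
    intro ω ω' hne
    have hex := Function.ne_iff.mp hne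
    classical
    refine ⟨Nat.find hex, fun i hi => not_not.mp (Nat.find_min hex hi), ?_⟩
    set j := Nat.find hex with hj
    have hpj : path ω j = path ω' j :=
      treePath_congr _ _ fun i hi => not_not.mp (Nat.find_min hex hi)
    refine hsep j _ (path ω j).2 (ω j) (ω' j) (Nat.find_spec hex) _ (hx' ω (j + 1)) _ ?_
    rw [hpj]
    exact hx' ω' (j + 1)
  have hb0 : (0 : ℝ) < b := by exact_mod_cast (zero_lt_one.trans hb)
  have hinj : Function.Injective x := by
    intro ω ω' heq
    by_contra hne
    obtain ⟨j, -, h⟩ := hdist ω ω' hne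
    rw [heq, sub_self, abs_zero, Real.zero_rpow (by exact_mod_cast hσ.ne'), mul_zero] at h
    exact absurd h (not_le.mpr (by positivity))
  have : Nonempty (ℕ → Fin b) := ⟨fun _ => ⟨0, by omega⟩⟩
  set f : ℝ → ℝ := fun y => Real.ofDigits (Function.invFun x y) with hf
  have hfx : ∀ ω, f (x ω) = Real.ofDigits ω := fun ω => by
    rw [hf]
    simp only [Function.leftInverse_invFun hinj ω]
  have hhol : HolderOnWith C σ f (range x) := by
    rintro _ ⟨ω, rfl⟩ _ ⟨ω', rfl⟩
    rw [hfx, hfx]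
    by_cases h : ω = ω'
    · simp [h]
    obtain ⟨j, h1, h2⟩ := hdist ω ω' h
    have h3 := (Real.abs_ofDigits_sub_ofDigits_le h1).trans h2
    rw [edist_dist, edist_dist, Real.dist_eq, Real.dist_eq, ENNReal.ofReal_rpow_of_nonneg
      (abs_nonneg _) σ.coe_nonneg, ← ENNReal.ofReal_coe_nnreal, ← ENNReal.ofReal_mul C.coe_nonneg]
    exact ENNReal.ofReal_le_ofReal h3
  have h1 : dimH (Icc (0 : ℝ) 1) = 1 := by
    rw [Real.dimH_of_nonempty_interior (by rw [interior_Icc]; exact ⟨1 / 2, by norm_num⟩)]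
    simp
  have h2 : Icc (0 : ℝ) 1 ⊆ f '' range x := by
    intro y hy
    obtain ⟨ω, -, rfl⟩ := Real.ofDigits_SurjOn hb hy
    exact ⟨x ω, ⟨ω, rfl⟩, hfx ω⟩
  have h3 : 1 ≤ dimH (range x) / σ := by
    rw [← h1]
    exact (dimH_mono h2).trans (hhol.dimH_image_le hσ)
  have h4 : (σ : ENNReal) ≤ dimH (range x) := by
    rw [ENNReal.le_div_iff_mul_le (Or.inl (by exact_mod_cast hσ.ne')) (Or.inl ENNReal.coe_ne_top),
      one_mul] at h3
    exact h3
  refine h4.trans (dimH_mono ?_)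
  rintro _ ⟨ω, rfl⟩
  exact hG _ fun j => ⟨_, (path ω j).2, hx' ω j⟩

/-- An interval `[a, a + ℓ]` of the `j`-th generation of the construction, all of whose points
satisfy the first `i` approximation conditions. The fields `len_pow` and `budget` keep track of the
loss of length caused by these conditions. -/
structure TreeNode (R e : ℕ) (N : ℕ → ℝ) (M : ℕ → ℕ) (δ : ℕ → ℝ) (j : ℕ) (a ℓ : ℝ) (i : ℕ) :
    Prop where
  pos : 0 < ℓ
  len_le : ℓ * (R : ℝ) ^ j ≤ 1
  good : GoodInterval R a ℓ
  le_len : ((2 : ℝ) ^ M i) ^ 402 ≤ ℓ * N i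
  len_pow : 1 ≤ ℓ ^ e * ((R : ℝ) ^ j) ^ (e + 1)
  budget : ((2 : ℝ) ^ M i) ^ (1000 * e) ≤ ℓ ^ (e + 1) * N i * ((R : ℝ) ^ j) ^ (e + 1)
  hit : ∀ i' < i, ∀ x ∈ Icc a (a + ℓ), nint (N i' * x - δ i') < 2 / 2 ^ M i'

theorem treeNode_zero {R e : ℕ} (hR : 1 ≤ R) (he : 1 ≤ e) {N : ℕ → ℝ} {M : ℕ → ℕ} {δ : ℕ → ℝ}
    (hN : ((2 : ℝ) ^ M 0) ^ (1000 * e) ≤ N 0) : TreeNode R e N M δ 0 0 1 0 where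
  pos := one_pos
  len_le := by simp
  good := by
    intro p q hq hs
    exfalso
    have h1 : (1 : ℝ) ≤ q := by exact_mod_cast hq
    have h2 : (1 : ℝ) ≤ R := by exact_mod_cast hR
    have h3 : (1 : ℝ) ≤ (q : ℝ) ^ 2 := one_le_pow₀ h1
    nlinarith
  le_len := by
    rw [one_mul]
    refine le_trans (pow_le_pow_right₀ (one_le_pow₀ (by norm_num)) (by omega)) hN
  len_pow := by simp
  budget := by simpa using hN
  hit := by intro i' hi'; omega

theorem TreeNode.exists_child {R e : ℕ} {N : ℕ → ℝ} {M : ℕ → ℕ} {δ : ℕ → ℝ} {j : ℕ} {a ℓ : ℝ}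
    {i : ℕ} (h : TreeNode R e N M δ j a ℓ i) (hR : 2 ^ 13 ≤ R) (he : 1 ≤ e) (hM : 6 ≤ M i)
    (hMR : 5000 * (R : ℝ) ^ 5 ≤ 2 ^ M i) (hMi : M i ≤ M (i + 1))
    (hN : N i * ((2 : ℝ) ^ M (i + 1)) ^ (1000 * e + 501) ≤ N (i + 1)) {a₁ : ℝ} (ha₁ : a ≤ a₁)
    (ha₁' : a₁ + ℓ / R ≤ a + ℓ) (hg : GoodInterval R a₁ (ℓ / R)) :
    ∃ a' ℓ' i', TreeNode R e N M δ (j + 1) a' ℓ' i' ∧ a₁ ≤ a' ∧ a' + ℓ' ≤ a₁ + ℓ / R := by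
  have hR1 : (1 : ℝ) ≤ R := by exact_mod_cast (by omega : 1 ≤ R)
  have hR0 : (0 : ℝ) < R := by linarith
  have hℓ := h.pos
  set ℓ₁ := ℓ / R with hℓ₁
  have eℓ : ℓ = ℓ₁ * R := by rw [hℓ₁]; field_simp
  have hℓ₁0 : 0 < ℓ₁ := by positivity
  have hlen : ℓ₁ * (R : ℝ) ^ (j + 1) ≤ 1 := by
    refine le_trans (le_of_eq ?_) h.len_le
    rw [eℓ]; ring
  have hbud : ((2 : ℝ) ^ M i) ^ (1000 * e) ≤ ℓ₁ ^ (e + 1) * N i * ((R : ℝ) ^ (j + 1)) ^ (e + 1) := by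
    refine le_trans h.budget (le_of_eq ?_)
    rw [eℓ]; ring
  have hpow : 1 ≤ ℓ₁ ^ e * ((R : ℝ) ^ (j + 1)) ^ (e + 1) := by
    calc 1 ≤ ℓ ^ e * ((R : ℝ) ^ j) ^ (e + 1) * 1 := by rw [mul_one]; exact h.len_pow
      _ ≤ ℓ ^ e * ((R : ℝ) ^ j) ^ (e + 1) * R := by gcongr
      _ = _ := by rw [eℓ]; ring
  have hhit : ∀ i' < i, ∀ x ∈ Icc a₁ (a₁ + ℓ₁), nint (N i' * x - δ i') < 2 / 2 ^ M i' :=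
    fun i' hi' x hx => h.hit i' hi' x ⟨ha₁.trans hx.1, hx.2.trans ha₁'⟩
  by_cases hc : ((2 : ℝ) ^ M i) ^ 402 ≤ ℓ₁ * N i
  · exact ⟨a₁, ℓ₁, i, ⟨hℓ₁0, hlen, hg, hc, hpow, hbud, hhit⟩, le_rfl, le_rfl⟩
  push Not at hc
  set X : ℝ := 2 ^ M i with hX
  set Y : ℝ := 2 ^ M (i + 1) with hY
  have hX1 : 1 ≤ X := one_le_pow₀ (by norm_num)
  have hX0 : 0 < X := by linarith
  have hXY : X ≤ Y := pow_le_pow_right₀ (by norm_num) hMi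
  have hRX : (R : ℝ) ≤ X := by
    refine le_trans ?_ hMR
    have : (R : ℝ) ≤ R ^ 5 := le_self_pow₀ hR1 (by norm_num)
    linarith
  have hNℓ : X ^ 401 ≤ N i * ℓ₁ := by
    refine le_of_mul_le_mul_right ?_ hR0
    calc X ^ 401 * R ≤ X ^ 401 * X := by gcongr
      _ = X ^ 402 := by ring
      _ ≤ ℓ * N i := h.le_len
      _ = N i * ℓ₁ * R := by rw [eℓ]; ring
  have hN0 : 0 < N i := by
    exact (mul_pos_iff_of_pos_right hℓ₁0).mp (lt_of_lt_of_le (by positivity) hNℓ)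
  have hℓ₁1 : ℓ₁ ≤ 1 := by
    refine le_trans ?_ hlen
    exact le_mul_of_one_le_right hℓ₁0.le (one_le_pow₀ hR1)
  obtain ⟨a', ℓ', h1, h2, h3, h4, h5, h6⟩ := hg.exists_hit hR hM hMR hℓ₁0 hℓ₁1 hNℓ
    (by
      rw [mul_comm]
      exact hc.le.trans (pow_le_pow_right₀ hX1 (by norm_num))) (δ i)
  have hℓ'1 : ℓ' ≤ ℓ₁ := by linarith
  have hle : Y ^ (1000 * e + 402) ≤ ℓ' * N (i + 1) := by
    refine le_of_mul_le_mul_left ?_ (by positivity : 0 < X ^ 500)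
    calc X ^ 500 * Y ^ (1000 * e + 402) = X ^ 401 * (X ^ 99 * Y ^ (1000 * e + 402)) := by ring
      _ ≤ X ^ 401 * (Y ^ 99 * Y ^ (1000 * e + 402)) := by gcongr
      _ = X ^ 401 * Y ^ (1000 * e + 501) := by ring
      _ ≤ N i * ℓ₁ * Y ^ (1000 * e + 501) := by gcongr
      _ ≤ N i * (X ^ 500 * ℓ') * Y ^ (1000 * e + 501) := by gcongr
      _ = X ^ 500 * ℓ' * (N i * Y ^ (1000 * e + 501)) := by ring
      _ ≤ X ^ 500 * ℓ' * N (i + 1) := by gcongr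
      _ = _ := by ring
  have hpow' : 1 ≤ ℓ' ^ e * ((R : ℝ) ^ (j + 1)) ^ (e + 1) := by
    refine le_of_mul_le_mul_left ?_ (by positivity : 0 < X ^ (500 * e) * X ^ 402)
    calc X ^ (500 * e) * X ^ 402 * 1 = X ^ (500 * e + 402) := by ring
      _ ≤ X ^ (1000 * e) := pow_le_pow_right₀ hX1 (by omega)
      _ ≤ ℓ₁ ^ (e + 1) * N i * ((R : ℝ) ^ (j + 1)) ^ (e + 1) := hbud
      _ = ℓ₁ ^ e * (ℓ₁ * N i) * ((R : ℝ) ^ (j + 1)) ^ (e + 1) := by ring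
      _ ≤ (X ^ 500 * ℓ') ^ e * X ^ 402 * ((R : ℝ) ^ (j + 1)) ^ (e + 1) := by gcongr
      _ = _ := by rw [mul_pow, ← pow_mul]; ring
  have hY1 : 1 ≤ Y := hX1.trans hXY
  refine ⟨a', ℓ', i + 1, ⟨h3, ?_, h5, ?_, hpow', ?_, ?_⟩, h1, h2⟩
  · exact le_trans (by gcongr) hlen
  · exact (pow_le_pow_right₀ hY1 (by omega)).trans hle
  · calc Y ^ (1000 * e) ≤ 1 * Y ^ (1000 * e + 402) := by
          rw [one_mul]; exact pow_le_pow_right₀ hY1 (by omega)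
      _ ≤ (ℓ' ^ e * ((R : ℝ) ^ (j + 1)) ^ (e + 1)) * (ℓ' * N (i + 1)) := by gcongr
      _ = _ := by ring
  · intro i' hi' x hx
    rcases Nat.lt_succ_iff_lt_or_eq.mp hi' with hlt | rfl
    · exact hhit i' hlt x ⟨h1.trans hx.1, hx.2.trans h2⟩
    · exact h6 x hx

theorem mem_bad_of_forall_goodInterval {R : ℕ} (hR : 1 < R) {x : ℝ}
    (h : ∀ j : ℕ, ∃ a ℓ : ℝ, GoodInterval R a ℓ ∧ ℓ * (R : ℝ) ^ j ≤ 1 ∧ x ∈ Icc a (a + ℓ)) :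
    x ∈ Bad := by
  have hR1 : (1 : ℝ) < R := by exact_mod_cast hR
  have hR0 : (0 : ℝ) < R := by linarith
  refine ⟨1 / (8 * R ^ 2), by positivity, fun q hq => ?_⟩
  have hq0 : (0 : ℝ) < q := by exact_mod_cast hq
  obtain ⟨j, hj⟩ := pow_unbounded_of_one_lt (2 * R * (q : ℝ) ^ 2) hR1
  obtain ⟨a, ℓ, hg, hℓ, hx⟩ := h j
  have hℓ0 : 0 ≤ ℓ := by linarith [hx.1, hx.2]
  have hs : 2 * R * ℓ * (q : ℝ) ^ 2 ≤ 1 := by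
    calc 2 * R * ℓ * (q : ℝ) ^ 2 = ℓ * (2 * R * q ^ 2) := by ring
      _ ≤ ℓ * R ^ j := by gcongr
      _ ≤ 1 := hℓ
  rw [← div_le_iff₀' hq0]
  refine le_ciInf fun p => ?_
  have := hg p q (by exact_mod_cast hq) (by exact_mod_cast hs) x hx
  rw [div_le_iff₀ hq0, div_le_iff₀ (by positivity)]
  push_cast at this
  linarith

theorem TreeNode.inv_pow_le {k e : ℕ} {N : ℕ → ℝ} {M : ℕ → ℕ} {δ : ℕ → ℝ} {j : ℕ} {a ℓ : ℝ}
    {i : ℕ} (h : TreeNode (4 * 2 ^ k) e N M δ j a ℓ i) :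
    ((2 ^ k : ℝ) ^ j)⁻¹ ≤ ℓ ^ ((k * e : ℝ) / ((k + 2) * (e + 1))) := by
  have hℓ := h.pos
  set θ : ℝ := k / ((k + 2) * (e + 1)) with hθ
  have hθ0 : 0 ≤ θ := by positivity
  have h1 := Real.one_le_rpow h.len_pow hθ0
  have e1 : ((((4 * 2 ^ k : ℕ) : ℝ) ^ j) ^ (e + 1)) = (2 : ℝ) ^ (((k + 2) * j * (e + 1) : ℝ)) := by
    have : ((4 * 2 ^ k : ℕ) : ℝ) = 2 ^ (k + 2) := by push_cast; ring
    rw [this, ← pow_mul, ← pow_mul, ← Real.rpow_natCast]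
    push_cast
    rw [mul_assoc]
  have e2 : (k + 2) * j * (e + 1) * θ = ((k * j : ℕ) : ℝ) := by
    rw [hθ]; push_cast; field_simp
  rw [e1, Real.mul_rpow (by positivity) (by positivity), ← Real.rpow_natCast, ← Real.rpow_mul hℓ.le,
    ← Real.rpow_mul (by norm_num), e2, Real.rpow_natCast, pow_mul] at h1
  have e3 : (e : ℝ) * θ = (k * e : ℝ) / ((k + 2) * (e + 1)) := by rw [hθ]; ring
  rw [e3] at h1
  rwa [inv_le_iff_one_le_mul₀ (by positivity)]

/-- The set of badly approximable numbers which satisfy a sparse sequence of approximation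
conditions has large Hausdorff dimension. -/
theorem le_dimH_of_hits {k e : ℕ} (hk : 11 ≤ k) (he : 1 ≤ e) {N : ℕ → ℝ} {M : ℕ → ℕ}
    {δ : ℕ → ℝ} (hM : ∀ i, 6 ≤ M i) (hMR : ∀ i, 5000 * ((4 * 2 ^ k : ℕ) : ℝ) ^ 5 ≤ 2 ^ M i)
    (hMi : ∀ i, M i ≤ M (i + 1)) (hN₀ : ((2 : ℝ) ^ M 0) ^ (1000 * e) ≤ N 0)
    (hN : ∀ i, N i * ((2 : ℝ) ^ M (i + 1)) ^ (1000 * e + 501) ≤ N (i + 1)) {G : Set ℝ}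
    (hG : ∀ x ∈ Bad, (∀ i, nint (N i * x - δ i) < 2 / 2 ^ M i) → x ∈ G) :
    ENNReal.ofReal ((k * e : ℝ) / ((k + 2) * (e + 1))) ≤ dimH G := by
  set R : ℕ := 4 * 2 ^ k with hR
  have hkR : 2 ^ 11 ≤ 2 ^ k := Nat.pow_le_pow_right (by norm_num) hk
  have hR13 : 2 ^ 13 ≤ R := by omega
  have hR1 : (1 : ℝ) < R := by exact_mod_cast (by omega : 1 < R)
  have hR0 : (0 : ℝ) < R := by linarith
  set s : ℝ := (k * e : ℝ) / ((k + 2) * (e + 1)) with hs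
  have hs0 : 0 < s := by
    have : (0 : ℝ) < k := by exact_mod_cast (by omega : 0 < k)
    have : (0 : ℝ) < e := by exact_mod_cast he
    positivity
  have hs' : ((s.toNNReal : NNReal) : ℝ) = s := Real.coe_toNNReal s hs0.le
  have hNpos : ∀ i, 0 < N i := by
    intro i
    induction i with
    | zero => exact lt_of_lt_of_le (by positivity) hN₀
    | succ i ih => exact lt_of_lt_of_le (by positivity) (hN i)
  have hNmono : Monotone N := by
    refine monotone_nat_of_le_succ fun i => le_trans ?_ (hN i)
    exact le_mul_of_one_le_right (hNpos i).le (one_le_pow₀ (one_le_pow₀ (by norm_num)))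
  have hd : ∀ d d' : Fin (2 ^ k), d ≠ d' → d < d' ∨ d' < d := fun d d' h => lt_or_gt_of_ne h
  refine le_dimH_of_tree (b := 2 ^ k) (C := (R : NNReal) ^ s) (σ := s.toNNReal) (by omega)
    (Real.toNNReal_pos.mpr hs0)
    (T := fun j I => ∃ a ℓ i, TreeNode R e N M δ j a ℓ i ∧ I = Icc a (a + ℓ))
    ⟨_, 0, 1, 0, treeNode_zero (by omega) he hN₀, rfl⟩ ?_ ?_ ?_
  · rintro j _ ⟨a, ℓ, i, h, rfl⟩
    exact ⟨isCompact_Icc, nonempty_Icc.mpr (by linarith [h.pos])⟩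
  · rintro j _ ⟨a, ℓ, i, h, rfl⟩
    have hℓ := h.pos
    obtain ⟨f, hf, hf2, hfg⟩ := GoodInterval.exists_separated_parts Nat.one_le_two_pow hℓ h.good
    rw [← hR] at hfg
    have hchild : ∀ d : Fin (2 ^ k), ∃ a' ℓ' i', TreeNode R e N M δ (j + 1) a' ℓ' i' ∧
        a + f d * (ℓ / R) ≤ a' ∧ a' + ℓ' ≤ a + f d * (ℓ / R) + ℓ / R ∧
        a + f d * (ℓ / R) + ℓ / R ≤ a + ℓ := by
      intro d
      obtain ⟨h1, h2⟩ := hfg d d.2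
      have h3 : a + f d * (ℓ / R) + ℓ / R ≤ a + ℓ := by
        have : (f d : ℝ) + 1 ≤ R := by exact_mod_cast h1
        calc a + f d * (ℓ / R) + ℓ / R = a + (f d + 1) * (ℓ / R) := by ring
          _ ≤ a + R * (ℓ / R) := by gcongr
          _ = a + ℓ := by field_simp
      obtain ⟨a', ℓ', i', h4, h5, h6⟩ := h.exists_child hR13 he (hM i) (hMR i) (hMi i) (hN i)
        (le_add_of_nonneg_right (by positivity)) h3 h2
      exact ⟨a', ℓ', i', h4, h5, h6, h3⟩
    choose a' ℓ' i' h1 h2 h3 h4 using hchild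
    have hsep : ∀ d d' : Fin (2 ^ k), d < d' → ∀ x ∈ Icc (a' d) (a' d + ℓ' d),
        ∀ y ∈ Icc (a' d') (a' d' + ℓ' d'), ℓ / R ≤ y - x := by
      intro d d' hdd x hx y hy
      have h5 : f d + 2 ≤ f d' := (hf2 d).trans (hf.monotone (by exact_mod_cast hdd))
      have h6 : (f d : ℝ) + 2 ≤ f d' := by exact_mod_cast h5
      have h7 : ((f d : ℝ) + 2) * (ℓ / R) ≤ f d' * (ℓ / R) := by gcongr
      linarith [hx.2, hy.1, h2 d', h3 d]
    refine ⟨fun d => Icc (a' d) (a' d + ℓ' d), fun d => ⟨⟨_, _, _, h1 d, rfl⟩, ?_⟩, ?_⟩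
    · refine Icc_subset_Icc (le_trans ?_ (h2 d)) ((h3 d).trans (h4 d))
      exact le_add_of_nonneg_right (by positivity)
    · intro d d' hne x hx y hy
      have h5 : ℓ / R ≤ |x - y| := by
        rcases hd d d' hne with hlt | hlt
        · rw [abs_sub_comm]
          exact (hsep d d' hlt x hx y hy).trans (le_abs_self _)
        · exact (hsep d' d hlt y hy x hx).trans (le_abs_self _)
      have h6 : ℓ ≤ R * |x - y| := by rwa [div_le_iff₀' hR0] at h5
      rw [hs', NNReal.coe_rpow, NNReal.coe_natCast, ← Real.mul_rpow hR0.le (abs_nonneg _)]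
      push_cast
      exact h.inv_pow_le.trans (Real.rpow_le_rpow hℓ.le h6 hs0.le)
  · intro x hx
    refine hG x (mem_bad_of_forall_goodInterval (R := R) (by omega) fun j => ?_) fun i => ?_
    · obtain ⟨_, ⟨a, ℓ, i, h, rfl⟩, hxI⟩ := hx j
      exact ⟨a, ℓ, h.good, h.len_le, hxI⟩
    · obtain ⟨j, hj⟩ := pow_unbounded_of_one_lt (N i) hR1
      obtain ⟨_, ⟨a, ℓ, i', h, rfl⟩, hxI⟩ := hx j
      by_cases hi : i < i'
      · exact h.hit i hi x hxI
      · exfalso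
        push Not at hi
        have h1 : (1 : ℝ) ≤ ℓ * N i' := (one_le_pow₀ (one_le_pow₀ (by norm_num))).trans h.le_len
        have h2 : ℓ * N i' ≤ ℓ * N i := mul_le_mul_of_nonneg_left (hNmono hi) h.pos.le
        have h3 : ℓ * N i < ℓ * (R : ℝ) ^ j := mul_lt_mul_of_pos_left hj h.pos
        linarith [h.len_le]

theorem nint_le_nint_add_int (x y : ℝ) (k : ℤ) : nint x ≤ nint y + |x - y - k| := by
  rw [← sub_le_iff_le_add]
  refine le_ciInf fun p => ?_
  have h1 := nint_le_abs_sub x (p + k)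
  have h2 := abs_add_le (x - y - k) (y - p)
  have e : x - y - k + (y - p) = x - ((p + k : ℤ) : ℝ) := by push_cast; ring
  rw [e] at h2
  linarith

/-- The numbers `t = 2 ^ m + i * m ^ 2 < 2 ^ (m + 1)` with `m ≥ m₁` and `i ≥ 1`. -/
def hitTimes (m₁ : ℕ) : Set ℕ :=
  {t | m₁ ≤ Nat.log 2 t ∧ ∃ i, 1 ≤ i ∧ t = 2 ^ Nat.log 2 t + i * Nat.log 2 t ^ 2}

theorem add_sq_le_of_mem_hitTimes {m₁ t t' : ℕ} (ht : t ∈ hitTimes m₁) (ht' : t' ∈ hitTimes m₁)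
    (h : t < t') : t + Nat.log 2 t' ^ 2 ≤ t' := by
  obtain ⟨-, i, hi, e⟩ := ht
  obtain ⟨-, i', hi', e'⟩ := ht'
  rcases (Nat.log_mono_right (b := 2) h.le).eq_or_lt with heq | hlt
  · rw [← heq] at e' ⊢
    have : i < i' := by
      by_contra hcon
      push Not at hcon
      have := Nat.mul_le_mul_right (Nat.log 2 t ^ 2) hcon
      omega
    have := Nat.mul_le_mul_right (Nat.log 2 t ^ 2) (Nat.succ_le_of_lt this)
    rw [Nat.succ_mul] at this
    omega
  · have h1 : t < 2 ^ (Nat.log 2 t + 1) := Nat.lt_pow_succ_log_self (by norm_num) t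
    have h2 : 2 ^ (Nat.log 2 t + 1) ≤ 2 ^ Nat.log 2 t' := Nat.pow_le_pow_right (by norm_num) hlt
    have := Nat.mul_le_mul_right (Nat.log 2 t' ^ 2) hi'
    omega

theorem exists_mem_hitTimes_near {m₁ m : ℕ} (hm₁ : m₁ ≤ m) (hm : 5 ≤ m) (δ : ℝ) :
    ∃ t ∈ hitTimes m₁, Nat.log 2 t = m ∧
      ∃ k : ℤ, |(t : ℝ) / 2 ^ m - δ - k| ≤ (m : ℝ) ^ 2 / 2 ^ m := by
  have hsq : m ^ 2 < 2 ^ m := by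
    clear hm₁
    induction m, hm using Nat.le_induction with
    | base => norm_num
    | succ j hj ih =>
      rw [pow_succ 2 j]
      nlinarith
  have hm0 : (0 : ℝ) < (m : ℝ) ^ 2 := by
    have : 0 < m := by omega
    positivity
  have hf0 := Int.fract_nonneg δ
  have hf1 : Int.fract δ * 2 ^ m < 2 ^ m := by
    have := mul_lt_mul_of_pos_right (Int.fract_lt_one δ) (by positivity : (0 : ℝ) < 2 ^ m)
    rwa [one_mul] at this
  obtain ⟨i, hi1, hi2, hi3⟩ : ∃ i : ℕ, 1 ≤ i ∧ (i : ℝ) * m ^ 2 < 2 ^ m ∧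
      |(i : ℝ) * m ^ 2 - Int.fract δ * 2 ^ m| ≤ (m : ℝ) ^ 2 := by
    have h1 := Nat.floor_le (by positivity : 0 ≤ Int.fract δ * 2 ^ m / (m : ℝ) ^ 2)
    have h2 := Nat.lt_floor_add_one (Int.fract δ * 2 ^ m / (m : ℝ) ^ 2)
    rw [le_div_iff₀ hm0] at h1
    rw [div_lt_iff₀ hm0] at h2
    rcases Nat.eq_zero_or_pos ⌊Int.fract δ * 2 ^ m / (m : ℝ) ^ 2⌋₊ with h0 | h0
    · refine ⟨1, le_rfl, by exact_mod_cast (one_mul (m ^ 2)).trans_lt hsq, ?_⟩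
      rw [h0] at h2
      push_cast at h2 ⊢
      have : 0 ≤ Int.fract δ * 2 ^ m := by positivity
      rw [abs_le]
      constructor <;> linarith
    · refine ⟨_, h0, h1.trans_lt hf1, ?_⟩
      rw [abs_le]
      constructor <;> linarith
  have hlog : Nat.log 2 (2 ^ m + i * m ^ 2) = m := by
    have : i * m ^ 2 < 2 ^ m := by exact_mod_cast hi2
    refine Nat.log_eq_of_pow_le_of_lt_pow (by omega) ?_
    rw [pow_succ 2]
    omega
  refine ⟨2 ^ m + i * m ^ 2, ⟨by rwa [hlog], i, hi1, by rw [hlog]⟩, hlog, 1 - ⌊δ⌋, ?_⟩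
  have e : ((2 ^ m + i * m ^ 2 : ℕ) : ℝ) / 2 ^ m - δ - ((1 - ⌊δ⌋ : ℤ) : ℝ)
      = ((i : ℝ) * m ^ 2 - Int.fract δ * 2 ^ m) / 2 ^ m := by
    rw [← Int.self_sub_floor]
    push_cast
    field_simp
    ring
  rw [e, abs_div, abs_of_pos (by positivity : (0 : ℝ) < 2 ^ m)]
  gcongr

theorem infinite_hitTimes (m₁ : ℕ) : (hitTimes m₁).Infinite := by
  refine Set.infinite_of_forall_exists_gt fun s => ?_
  obtain ⟨t, ht, hlog, -⟩ := exists_mem_hitTimes_near (m₁ := m₁) (m := m₁ + 5 + s) (by omega)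
    (by omega) 0
  refine ⟨t, ht, ?_⟩
  have := Nat.log_le_self 2 t
  omega

theorem infinite_setOf_nint_lt {m₁ : ℕ} {n : ℕ → ℕ} {β : ℝ}
    (h : ∀ t ∈ hitTimes m₁, nint ((n t : ℝ) * β - (t : ℝ) / 2 ^ Nat.log 2 t) < 2 / 2 ^ Nat.log 2 t)
    {ε : ℝ} (hε : 0 < ε) (δ : ℝ) :
    Set.Infinite {t : ℕ | 0 < t ∧ nint ((n t : ℝ) * β - δ) < Real.log t ^ ((3 : ℝ) + ε) / t} := by
  refine Set.infinite_of_forall_exists_gt fun s => ?_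
  obtain ⟨t, ht, hlog, k, hk⟩ := exists_mem_hitTimes_near (m₁ := m₁) (m := m₁ + 18 + s) (by omega)
    (by omega) δ
  set m := m₁ + 18 + s with hm
  have hlt : s < t := by
    have := Nat.log_le_self 2 t
    omega
  have ht0 : 0 < t := by omega
  refine ⟨t, ⟨ht0, ?_⟩, hlt⟩
  have h1 := h t ht
  rw [hlog] at h1
  have h2 := nint_le_nint_add_int ((n t : ℝ) * β - δ) ((n t : ℝ) * β - (t : ℝ) / 2 ^ m) k
  have e : (n t : ℝ) * β - δ - ((n t : ℝ) * β - (t : ℝ) / 2 ^ m) - k = (t : ℝ) / 2 ^ m - δ - k := by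
    ring
  rw [e] at h2
  have hm18 : (18 : ℝ) ≤ m := by exact_mod_cast (by omega : 18 ≤ m)
  have hlow : (2 : ℝ) ^ m ≤ t := by
    have := Nat.pow_log_le_self 2 ht0.ne'
    rw [hlog] at this
    exact_mod_cast this
  have hupp : (t : ℝ) ≤ 2 * 2 ^ m := by
    have := (Nat.lt_pow_succ_log_self (b := 2) (by norm_num) t).le
    rw [hlog, pow_succ'] at this
    exact_mod_cast this
  have ht0' : (0 : ℝ) < t := by exact_mod_cast ht0
  have h3 : (m : ℝ) / 2 ≤ Real.log t := by
    calc (m : ℝ) / 2 ≤ m * Real.log 2 := by nlinarith [Real.log_two_gt_d9]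
      _ = Real.log (2 ^ m) := by rw [Real.log_pow]
      _ ≤ Real.log t := Real.log_le_log (by positivity) hlow
  have h4 : 2 * ((m : ℝ) ^ 2 + 2) ≤ Real.log t ^ ((3 : ℝ) + ε) := by
    calc 2 * ((m : ℝ) ^ 2 + 2) ≤ (m / 2) ^ 3 := by
          nlinarith [mul_nonneg (sq_nonneg (m : ℝ)) (sub_nonneg.mpr hm18)]
      _ ≤ Real.log t ^ 3 := by gcongr
      _ = Real.log t ^ (3 : ℝ) := by norm_cast
      _ ≤ _ := Real.rpow_le_rpow_of_exponent_le (by linarith) (by linarith)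
  rw [lt_div_iff₀ ht0']
  have h5 : nint ((n t : ℝ) * β - δ) < ((m : ℝ) ^ 2 + 2) / 2 ^ m := by
    rw [add_div]
    linarith
  calc nint ((n t : ℝ) * β - δ) * t < ((m : ℝ) ^ 2 + 2) / 2 ^ m * t := by gcongr
    _ ≤ ((m : ℝ) ^ 2 + 2) / 2 ^ m * (2 * 2 ^ m) := by gcongr
    _ = 2 * ((m : ℝ) ^ 2 + 2) := by field_simp
    _ ≤ _ := h4

theorem pow_mul_le_of_lacunary {n : ℕ → ℕ} {r : ℝ} (hr : 0 ≤ r)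
    (h : ∀ t, 1 ≤ t → r * n t ≤ n (t + 1)) {t : ℕ} (ht : 1 ≤ t) (s : ℕ) :
    r ^ s * n t ≤ n (t + s) := by
  induction s with
  | zero => simp
  | succ s ih =>
    calc r ^ (s + 1) * n t = r * (r ^ s * n t) := by ring
      _ ≤ r * n (t + s) := by gcongr
      _ ≤ _ := h (t + s) (by omega)

theorem mul_two_pow_le_of_lacunary {n : ℕ → ℕ} {r : ℝ} (hr : 1 ≤ r)
    (h : ∀ t, 1 ≤ t → r * n t ≤ n (t + 1)) {t t' m m₁ B : ℕ} (ht : 1 ≤ t)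
    (htt : t + m ^ 2 ≤ t') (hm : m₁ ≤ m) (hB : (2 : ℝ) ^ B ≤ r ^ m₁) :
    n t * ((2 : ℝ) ^ m) ^ B ≤ n t' := by
  have h1 : (2 : ℝ) ^ B ≤ r ^ m := hB.trans (pow_le_pow_right₀ hr hm)
  calc n t * ((2 : ℝ) ^ m) ^ B = ((2 : ℝ) ^ B) ^ m * n t := by
        rw [← pow_mul, ← pow_mul, mul_comm m, mul_comm]
    _ ≤ (r ^ m) ^ m * n t := by gcongr
    _ = r ^ (m ^ 2) * n t := by rw [← pow_mul, sq]
    _ ≤ r ^ (t' - t) * n t := by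
        have : m ^ 2 ≤ t' - t := by omega
        gcongr
    _ ≤ n (t + (t' - t)) := pow_mul_le_of_lacunary (by linarith) h ht _
    _ = n t' := by rw [Nat.add_sub_cancel' (by omega)]

theorem le_dimH_bad_infinite {n : ℕ → ℕ} (hpos : ∀ t, 1 ≤ t → 0 < n t) {r : ℝ} (hr : 1 < r)
    (hlac : ∀ t, 1 ≤ t → r * n t ≤ n (t + 1)) {ε : ℝ} (hε : 0 < ε) {k : ℕ} (hk : 11 ≤ k) :
    ENNReal.ofReal ((k * k : ℝ) / ((k + 2) * (k + 1))) ≤ dimH {β ∈ Bad | ∀ δ : ℝ,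
      Set.Infinite {t : ℕ | 0 < t ∧
        nint ((n t : ℝ) * β - δ) < Real.log t ^ ((3 : ℝ) + ε) / t}} := by
  obtain ⟨m₂, hm₂⟩ := pow_unbounded_of_one_lt ((2 : ℝ) ^ (1000 * k + 501)) hr
  obtain ⟨m₃, hm₃⟩ := pow_unbounded_of_one_lt (5000 * ((4 * 2 ^ k : ℕ) : ℝ) ^ 5) one_lt_two
  set m₁ := max 6 (max m₂ m₃) with hm₁
  have hB : (2 : ℝ) ^ (1000 * k + 501) ≤ r ^ m₁ :=
    hm₂.le.trans (pow_le_pow_right₀ hr.le (by omega))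
  set τ := Nat.nth (· ∈ hitTimes m₁) with hτ
  have hinf : {t | t ∈ hitTimes m₁}.Infinite := infinite_hitTimes m₁
  have hmem : ∀ i, τ i ∈ hitTimes m₁ := Nat.nth_mem_of_infinite hinf
  have hmono : StrictMono τ := Nat.nth_strictMono hinf
  have hM : ∀ i, m₁ ≤ Nat.log 2 (τ i) := fun i => (hmem i).1
  have hτ1 : ∀ i, 1 ≤ τ i := fun i => by
    have := Nat.log_le_self 2 (τ i)
    have := hM i
    omega
  refine le_dimH_of_hits hk (by omega) (N := fun i => (n (τ i) : ℝ)) (M := fun i => Nat.log 2 (τ i))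
    (δ := fun i => (τ i : ℝ) / 2 ^ Nat.log 2 (τ i)) (fun i => le_trans (by omega) (hM i))
    (fun i => hm₃.le.trans (pow_le_pow_right₀ (by norm_num) (le_trans (by omega) (hM i))))
    (fun i => Nat.log_mono_right (hmono (Nat.lt_succ_self i)).le) ?_ (fun i => ?_) ?_
  · obtain ⟨-, i, hi, e⟩ := hmem 0
    have h1 : (1 : ℝ) ≤ n 1 := by exact_mod_cast hpos 1 le_rfl
    have h2 : 1 + Nat.log 2 (τ 0) ^ 2 ≤ τ 0 := by
      have := Nat.mul_le_mul_right (Nat.log 2 (τ 0) ^ 2) hi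
      have := Nat.one_le_two_pow (n := Nat.log 2 (τ 0))
      omega
    have h3 := mul_two_pow_le_of_lacunary hr.le hlac le_rfl h2 (hM 0) hB
    refine le_trans ?_ h3
    calc ((2 : ℝ) ^ Nat.log 2 (τ 0)) ^ (1000 * k)
        ≤ 1 * (2 ^ Nat.log 2 (τ 0)) ^ (1000 * k + 501) := by
          rw [one_mul]
          exact pow_le_pow_right₀ (one_le_pow₀ (by norm_num)) (by omega)
      _ ≤ _ := by gcongr
  · exact mul_two_pow_le_of_lacunary hr.le hlac (hτ1 i)
      (add_sq_le_of_mem_hitTimes (hmem i) (hmem (i + 1)) (hmono (Nat.lt_succ_self i))) (hM _) hB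
  · intro β hβ hhit
    refine ⟨hβ, fun δ => infinite_setOf_nint_lt (m₁ := m₁) (fun t ht => ?_) hε δ⟩
    obtain ⟨i, rfl⟩ : t ∈ range τ := by
      rw [hτ, Nat.range_nth_of_infinite hinf]
      exact ht
    exact hhit i

theorem lacunary_bad (n : ℕ → ℕ) (hpos : ∀ t, 1 ≤ t → 0 < n t)
    (hlac : ∃ r : ℝ, 1 < r ∧ ∀ t, 1 ≤ t → r * n t ≤ n (t + 1))
    (ε : ℝ) (hε : 0 < ε) :
    ∃ G : Set ℝ, G ⊆ Bad ∧ dimH G = 1 ∧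
      ∀ β ∈ G, ∀ δ : ℝ,
        Set.Infinite {t : ℕ | 0 < t ∧ nint ((n t : ℝ) * β - δ) < Real.log t ^ ((3 : ℝ) + ε) / t} := by
  obtain ⟨r, hr, hlac⟩ := hlac
  refine ⟨{β ∈ Bad | ∀ δ : ℝ, Set.Infinite {t : ℕ | 0 < t ∧
    nint ((n t : ℝ) * β - δ) < Real.log t ^ ((3 : ℝ) + ε) / t}}, fun β hβ => hβ.1,
    le_antisymm ?_ ?_, fun β hβ => hβ.2⟩
  · rw [← Real.dimH_univ]
    exact dimH_mono (subset_univ _)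
  · have h1 : Filter.Tendsto (fun k : ℕ => ENNReal.ofReal (1 - 3 / k)) Filter.atTop (nhds 1) := by
      rw [← ENNReal.ofReal_one]
      refine ENNReal.tendsto_ofReal ?_
      simpa using (tendsto_const_div_atTop_nhds_zero_nat (3 : ℝ)).const_sub 1
    refine le_of_tendsto h1 ?_
    filter_upwards [Filter.eventually_ge_atTop 11] with k hk
    refine le_trans (ENNReal.ofReal_le_ofReal ?_) (le_dimH_bad_infinite hpos hr hlac hε hk)
    have hk0 : (0 : ℝ) < k := by exact_mod_cast (by omega : 0 < k)
    rw [one_sub_div hk0.ne', div_le_div_iff₀ hk0 (by positivity)]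
    nlinarith
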